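/- arXiv:2508.20696 — 3 statements merged into one kernel-verified Lean document; each statement's English description precedes it below -/
import Mathlib

section
/- For every integer r ≥ 3 there exists a quasi-linear, head-tail-mixing r-graph F which admits the descriptive sequence XX…XZZYY…Y (consisting of r−2 letters X, then two letters Z, then r−2 letters Y). -/
namespace UTD

/-- An `r`-uniform hypergraph on a finite vertex set of naturals. -/
structure RGraph (r : ℕ) where
  verts : Finset ℕ
  edges : Finset (Finset ℕ)
  edges_subset : ∀ e ∈ edges, e ⊆ verts
  edges_card : ∀ e ∈ edges, e.card = r

/-- `F` is a subgraph of `H`: an injection of `V(F)` into `V(H)` mapping edges to edges. -/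
def IsSubgraph {r : ℕ} (F H : RGraph r) : Prop :=
  ∃ φ : ℕ → ℕ, Set.InjOn φ ↑F.verts ∧ (∀ v ∈ F.verts, φ v ∈ H.verts) ∧
    ∀ e ∈ F.edges, e.image φ ∈ H.edges

/-- `H` is `(d, ε)`-dense: every `S ⊆ V(H)` with `|S| ≥ ε|V(H)|` spans at least
`(d - ε) * C(|S|, r)` edges. -/
def IsDense {r : ℕ} (H : RGraph r) (d ε : ℝ) : Prop :=
  ∀ S ⊆ H.verts, ε * H.verts.card ≤ S.card →
    (d - ε) * (S.card.choose r : ℝ) ≤ ((H.edges.filter (fun e => e ⊆ S)).card : ℝ)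

/-- A sequence of `r`-graphs is locally `d`-dense. -/
def LocallyDense {r : ℕ} (H : ℕ → RGraph r) (d : ℝ) : Prop :=
  ∃ ε : ℕ → ℝ, (∀ n, 0 < ε n) ∧
    Filter.Tendsto ε Filter.atTop (nhds 0) ∧
    Filter.Tendsto (fun n => (H n).verts.card) Filter.atTop Filter.atTop ∧
    ∀ n, IsDense (H n) d (ε n)

/-- The role (set of ranks, 1-indexed) that the elements of `p` play within the
set `e`, with respect to the order given by `ord`. -/
def role (ord : ℕ → ℕ) (e p : Finset ℕ) : Finset ℕ :=
  p.image (fun v => (e.filter (fun w => ord w < ord v)).card + 1)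

/-- Twin pair of edges: distinct edges intersecting in exactly two vertices. -/
def IsTwin {r : ℕ} (F : RGraph r) (e f : Finset ℕ) : Prop :=
  e ∈ F.edges ∧ f ∈ F.edges ∧ e ≠ f ∧ (e ∩ f).card = 2

/-- Quasi-linear: every edge `e` has a unique twin, and all other edges meet `e`
in at most one vertex. -/
def QuasiLinear {r : ℕ} (F : RGraph r) : Prop :=
  ∀ e ∈ F.edges, ∃ f ∈ F.edges, f ≠ e ∧ (e ∩ f).card = 2 ∧
    ∀ f' ∈ F.edges, f' ≠ e → f' ≠ f → (e ∩ f').card ≤ 1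

/-- `F` with the vertex order `ord` is consistently ordered. -/
def ConsistentlyOrdered {r : ℕ} (F : RGraph r) (ord : ℕ → ℕ) : Prop :=
  ∀ e f, IsTwin F e f → role ord e (e ∩ f) = role ord f (e ∩ f)

/-- `F` is consistent: some linear order of its vertices makes it consistently ordered. -/
def Consistent {r : ℕ} (F : RGraph r) : Prop :=
  ∃ ord : ℕ → ℕ, Set.InjOn ord ↑F.verts ∧ ConsistentlyOrdered F ord

/-- `p` is the head of the edge `e`: its two smallest vertices w.r.t. `ord`. -/
def IsHead (ord : ℕ → ℕ) (e p : Finset ℕ) : Prop :=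
  p ⊆ e ∧ p.card = 2 ∧ ∀ u ∈ p, ∀ w ∈ e, w ∉ p → ord u < ord w

/-- `p` is the tail of the edge `e`: its two largest vertices w.r.t. `ord`. -/
def IsTail (ord : ℕ → ℕ) (e p : Finset ℕ) : Prop :=
  p ⊆ e ∧ p.card = 2 ∧ ∀ u ∈ p, ∀ w ∈ e, w ∉ p → ord w < ord u

/-- Head-tail-mixing: for every linear order of the vertex set there are edges
`e, f` such that the head of `e` equals the tail of `f`. -/
def HeadTailMixing {r : ℕ} (F : RGraph r) : Prop :=
  ∀ ord : ℕ → ℕ, Set.InjOn ord ↑F.verts →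
    ∃ e ∈ F.edges, ∃ f ∈ F.edges, ∃ p : Finset ℕ, IsHead ord e p ∧ IsTail ord f p

inductive Letter : Type
  | X | Y | Z
  deriving DecidableEq

/-- A descriptive sequence of order `r`: `2r - 2` letters, among which `r - 2`
are `X`, `r - 2` are `Y`, and two are `Z`. -/
def IsDescSeq (r : ℕ) (σ : Fin (2 * r - 2) → Letter) : Prop :=
  (Finset.univ.filter (fun i => σ i = Letter.X)).card = r - 2 ∧
  (Finset.univ.filter (fun i => σ i = Letter.Y)).card = r - 2 ∧
  (Finset.univ.filter (fun i => σ i = Letter.Z)).card = 2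

/-- The descriptive sequence `XX…XZZYY…Y`. -/
def headTailSeq (r : ℕ) : Fin (2 * r - 2) → Letter := fun i =>
  if (i : ℕ) < r - 2 then Letter.X
  else if (i : ℕ) < r then Letter.Z
  else Letter.Y

/-- The role (set of ranks, 1-indexed) played by the positions of the two `Z`s
within the positions carrying letters different from `avoid`. -/
def seqRole (r : ℕ) (σ : Fin (2 * r - 2) → Letter) (avoid : Letter) : Finset ℕ :=
  (Finset.univ.filter (fun i => σ i = Letter.Z)).image
    (fun i => (Finset.univ.filter (fun j => σ j ≠ avoid ∧ j < i)).card + 1)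

/-- A descriptive sequence is consistent if its two `Z`s play the same role among
the `X/Z` positions as among the `Y/Z` positions. -/
def SeqConsistent (r : ℕ) (σ : Fin (2 * r - 2) → Letter) : Prop :=
  seqRole r σ Letter.Y = seqRole r σ Letter.X

def SeqInconsistent (r : ℕ) (σ : Fin (2 * r - 2) → Letter) : Prop :=
  IsDescSeq r σ ∧ ¬ SeqConsistent r σ

/-- The descriptive sequence `σ` describes the pair of edges `{e, f}` under the
vertex order `ord`. -/
def Describes (r : ℕ) (σ : Fin (2 * r - 2) → Letter) (ord : ℕ → ℕ)
    (e f : Finset ℕ) : Prop :=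
  ∃ w : Fin (2 * r - 2) → ℕ,
    (∀ i j : Fin (2 * r - 2), i < j → ord (w i) < ord (w j)) ∧
    (∀ v : ℕ, v ∈ e ∪ f ↔ ∃ i, w i = v) ∧
    (((∀ i, w i ∈ e ↔ σ i ≠ Letter.Y) ∧ (∀ i, w i ∈ f ↔ σ i ≠ Letter.X)) ∨
     ((∀ i, w i ∈ e ↔ σ i ≠ Letter.X) ∧ (∀ i, w i ∈ f ↔ σ i ≠ Letter.Y)))

/-- A quasi-linear `r`-graph admits the descriptive sequence `σ`: there is a
linear order of its vertices in which every twin pair of edges is described by `σ`. -/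
def AdmitsSeq {r : ℕ} (F : RGraph r) (σ : Fin (2 * r - 2) → Letter) : Prop :=
  ∃ ord : ℕ → ℕ, Set.InjOn ord ↑F.verts ∧
    ∀ e f, IsTwin F e f → Describes r σ ord e f

/-- Linear hypergraph: any two distinct edges intersect in at most one vertex. -/
def LinearGraph {r : ℕ} (H : RGraph r) : Prop :=
  ∀ e ∈ H.edges, ∀ f ∈ H.edges, e ≠ f → (e ∩ f).card ≤ 1

/-- Nowhere-empty sequence of `r`-graphs. -/
def NowhereEmpty {r : ℕ} (H : ℕ → RGraph r) : Prop :=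
  ∀ c : ℝ, 0 < c → ∃ n₀ : ℕ, ∀ n ≥ n₀, ∀ S : Fin r → Finset ℕ,
    (∀ i, S i ⊆ (H n).verts) →
    (∀ i j, i ≠ j → Disjoint (S i) (S j)) →
    (∀ i, c * (H n).verts.card ≤ (S i).card) →
    ∃ e ∈ (H n).edges, ∀ i, (e ∩ S i).Nonempty

/-- A `(k, r)`-reduced hypergraph. -/
structure ReducedGraph (k r : ℕ) where
  part : Fin k → Fin k → Finset ℕ
  part_symm : ∀ i j, part i j = part j i
  part_disj : ∀ i j i' j' : Fin k, i < j → i' < j' → (i, j) ≠ (i', j') →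
    Disjoint (part i j) (part i' j')
  edges : Finset (Finset ℕ)
  edges_card : ∀ e ∈ edges, e.card = r.choose 2
  edges_struct : ∀ e ∈ edges, ∃ t : Fin r → Fin k, StrictMono t ∧
    ∀ a b : Fin r, a < b → (e ∩ part (t a) (t b)).card = 1

/-- The constituent `A_{t 0, …, t (r-1)}` of a reduced hypergraph. -/
def constituent {k r : ℕ} (H : ReducedGraph k r) (t : Fin r → Fin k) :
    Finset (Finset ℕ) :=
  H.edges.filter (fun e => ∀ a b : Fin r, a < b → (e ∩ H.part (t a) (t b)).card = 1)

/-- A reduced hypergraph has density at least `d`. -/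
def HasDensity {k r : ℕ} (H : ReducedGraph k r) (d : ℝ) : Prop :=
  ∀ t : Fin r → Fin k, StrictMono t →
    d * ∏ p ∈ Finset.univ.filter (fun p : Fin r × Fin r => p.1 < p.2),
      ((H.part (t p.1) (t p.2)).card : ℝ) ≤ ((constituent H t).card : ℝ)

/-- The `(2r-2)`-tuple of indices `t` admits the descriptive sequence `σ` in the
reduced hypergraph `H`. -/
def TupleAdmits {k r : ℕ} (H : ReducedGraph k r) (σ : Fin (2 * r - 2) → Letter)
    (t : Fin (2 * r - 2) → Fin k) : Prop :=
  ∃ tx ty : Fin r → Fin k, StrictMono tx ∧ StrictMono ty ∧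
    Set.range tx = t '' {i | σ i ≠ Letter.Y} ∧
    Set.range ty = t '' {i | σ i ≠ Letter.X} ∧
    ∃ eX ∈ constituent H tx, ∃ eY ∈ constituent H ty, (eX ∩ eY).card = 1

/-- The uniform Turán density threshold `C(r,2)^(-C(r,2))`. -/
noncomputable def piR (r : ℕ) : ℝ := ((r.choose 2 : ℝ) ^ (r.choose 2))⁻¹


theorem of_tuples (r : ℕ) (hr : 3 ≤ r) {ι : Type} [Fintype ι]
    (w : ι → Fin (2 * r - 2) → ℕ) (hw : ∀ a, StrictMono (w a))
    (hlin : ∀ a b, a ≠ b → ∀ i j i' j', w a i = w b i' → w a j = w b j' → i = j)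
    (hmix : ∀ ord : ℕ → ℕ, Set.InjOn ord {v | ∃ a i, w a i = v} →
      ∃ a, StrictMono (fun i => ord (w a i)) ∨ StrictAnti (fun i => ord (w a i))) :
    ∃ F : RGraph r, QuasiLinear F ∧ HeadTailMixing F ∧ AdmitsSeq F (headTailSeq r) := by
  classical
  let e : ι → Finset ℕ := fun a => (Finset.univ.filter (fun i : Fin (2 * r - 2) => (i : ℕ) < r)).image (w a)
  let f : ι → Finset ℕ := fun a => (Finset.univ.filter (fun i : Fin (2 * r - 2) => r - 2 ≤ (i : ℕ))).image (w a)
  let p : ι → Finset ℕ := fun a =>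
    (Finset.univ.filter (fun i : Fin (2 * r - 2) => r - 2 ≤ (i : ℕ) ∧ (i : ℕ) < r)).image (w a)
  have winj : ∀ a, Function.Injective (w a) := fun a => (hw a).injective
  have mem_e : ∀ a i, w a i ∈ e a ↔ (i : ℕ) < r := by
    intro a i
    simp only [e, Finset.mem_image, Finset.mem_filter, Finset.mem_univ, true_and]
    exact ⟨fun ⟨j, hj, h⟩ => winj a h ▸ hj, fun h => ⟨i, h, rfl⟩⟩
  have mem_f : ∀ a i, w a i ∈ f a ↔ r - 2 ≤ (i : ℕ) := by
    intro a i
    simp only [f, Finset.mem_image, Finset.mem_filter, Finset.mem_univ, true_and]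
    exact ⟨fun ⟨j, hj, h⟩ => winj a h ▸ hj, fun h => ⟨i, h, rfl⟩⟩
  have mem_p : ∀ a i, w a i ∈ p a ↔ r - 2 ≤ (i : ℕ) ∧ (i : ℕ) < r := by
    intro a i
    simp only [p, Finset.mem_image, Finset.mem_filter, Finset.mem_univ, true_and]
    exact ⟨fun ⟨j, hj, h⟩ => winj a h ▸ hj, fun h => ⟨i, h, rfl⟩⟩
  have e_range : ∀ a v, v ∈ e a → ∃ i, w a i = v := by
    intro a v hv
    obtain ⟨i, -, h⟩ := Finset.mem_image.1 hv
    exact ⟨i, h⟩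
  have f_range : ∀ a v, v ∈ f a → ∃ i, w a i = v := by
    intro a v hv
    obtain ⟨i, -, h⟩ := Finset.mem_image.1 hv
    exact ⟨i, h⟩
  have p_range : ∀ a v, v ∈ p a → ∃ i, w a i = v := by
    intro a v hv
    obtain ⟨i, -, h⟩ := Finset.mem_image.1 hv
    exact ⟨i, h⟩
  have card_aux : ∀ l u : ℕ, u ≤ 2 * r - 2 →
      (Finset.univ.filter (fun i : Fin (2 * r - 2) => l ≤ (i : ℕ) ∧ (i : ℕ) < u)).card = u - l := by
    intro l u hu
    refine Eq.trans ?_ (Nat.card_Ico l u)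
    refine Eq.trans (Finset.card_map Fin.valEmbedding).symm ?_
    congr 1
    ext x
    simp only [Finset.mem_map, Finset.mem_filter, Finset.mem_univ, true_and, Fin.valEmbedding_apply,
      Finset.mem_Ico]
    exact ⟨fun ⟨i, h, hi⟩ => hi ▸ h, fun h => ⟨⟨x, by omega⟩, h, rfl⟩⟩
  have card_e : ∀ a, (e a).card = r := by
    intro a
    rw [Finset.card_image_of_injective _ (winj a)]
    have := card_aux 0 r (by omega)
    simpa using this
  have card_f : ∀ a, (f a).card = r := by
    intro a
    rw [Finset.card_image_of_injective _ (winj a)]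
    have := card_aux (r - 2) (2 * r - 2) (by omega)
    refine Eq.trans ?_ (this.trans (by omega))
    congr 1
    ext i
    have := i.2
    simp
  have card_p : ∀ a, (p a).card = 2 := by
    intro a
    rw [Finset.card_image_of_injective _ (winj a), card_aux _ _ (by omega)]
    omega
  have inter : ∀ a, e a ∩ f a = p a := by
    intro a
    ext v
    rw [Finset.mem_inter]
    constructor
    · rintro ⟨h1, h2⟩
      obtain ⟨i, rfl⟩ := e_range a v h1
      exact (mem_p a i).2 ⟨(mem_f a i).1 h2, (mem_e a i).1 h1⟩
    · intro h
      obtain ⟨i, rfl⟩ := p_range a v h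
      exact ⟨(mem_e a i).2 ((mem_p a i).1 h).2, (mem_f a i).2 ((mem_p a i).1 h).1⟩
  have ne : ∀ a, e a ≠ f a := by
    intro a h
    have h1 := inter a
    rw [← h, Finset.inter_self] at h1
    have := card_p a
    rw [← h1, card_e] at this
    omega
  have small : ∀ a b, a ≠ b → ∀ s t : Finset ℕ, (s = e a ∨ s = f a) → (t = e b ∨ t = f b) →
      (s ∩ t).card ≤ 1 := by
    intro a b hab s t hs ht
    have hs' : ∀ v ∈ s, ∃ i, w a i = v := by
      rcases hs with rfl | rfl
      exacts [e_range a, f_range a]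
    have ht' : ∀ v ∈ t, ∃ i, w b i = v := by
      rcases ht with rfl | rfl
      exacts [e_range b, f_range b]
    rw [Finset.card_le_one]
    intro x hx y hy
    rw [Finset.mem_inter] at hx hy
    obtain ⟨i, hi⟩ := hs' x hx.1
    obtain ⟨i', hi'⟩ := ht' x hx.2
    obtain ⟨j, hj⟩ := hs' y hy.1
    obtain ⟨j', hj'⟩ := ht' y hy.2
    have := hlin a b hab i j i' j' (hi.trans hi'.symm) (hj.trans hj'.symm)
    rw [← hi, ← hj, this]
  let F : RGraph r :=
    { verts := Finset.univ.biUnion (fun a => Finset.univ.image (w a))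
      edges := Finset.univ.image e ∪ Finset.univ.image f
      edges_subset := by
        intro s hs v hv
        simp only [Finset.mem_biUnion, Finset.mem_univ, true_and, Finset.mem_image]
        simp only [Finset.mem_union, Finset.mem_image, Finset.mem_univ, true_and] at hs
        rcases hs with ⟨a, rfl⟩ | ⟨a, rfl⟩
        · exact ⟨a, e_range a v hv⟩
        · exact ⟨a, f_range a v hv⟩
      edges_card := by
        intro s hs
        simp only [Finset.mem_union, Finset.mem_image, Finset.mem_univ, true_and] at hs
        rcases hs with ⟨a, rfl⟩ | ⟨a, rfl⟩
        · exact card_e a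
        · exact card_f a }
  have mem_edges : ∀ s, s ∈ F.edges ↔ ∃ a, s = e a ∨ s = f a := by
    intro s
    simp only [F, Finset.mem_union, Finset.mem_image, Finset.mem_univ, true_and]
    constructor
    · rintro (⟨a, rfl⟩ | ⟨a, rfl⟩)
      exacts [⟨a, Or.inl rfl⟩, ⟨a, Or.inr rfl⟩]
    · rintro ⟨a, rfl | rfl⟩
      exacts [Or.inl ⟨a, rfl⟩, Or.inr ⟨a, rfl⟩]
  have edge_e : ∀ a, e a ∈ F.edges := fun a => (mem_edges _).2 ⟨a, Or.inl rfl⟩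
  have edge_f : ∀ a, f a ∈ F.edges := fun a => (mem_edges _).2 ⟨a, Or.inr rfl⟩
  have mem_verts : ∀ v, v ∈ F.verts ↔ ∃ a i, w a i = v := by
    intro v
    simp [F]
  refine ⟨F, ?_, ?_, ?_⟩
  · intro s hs
    obtain ⟨a, rfl | rfl⟩ := (mem_edges s).1 hs
    · refine ⟨f a, edge_f a, (ne a).symm, by rw [inter, card_p], ?_⟩
      intro t ht h1 h2
      obtain ⟨b, hb⟩ := (mem_edges t).1 ht
      refine small a b ?_ _ _ (Or.inl rfl) hb
      rintro rfl
      tauto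
    · refine ⟨e a, edge_e a, ne a, by rw [Finset.inter_comm, inter, card_p], ?_⟩
      intro t ht h1 h2
      obtain ⟨b, hb⟩ := (mem_edges t).1 ht
      refine small a b ?_ _ _ (Or.inr rfl) hb
      rintro rfl
      tauto
  · intro ord hord
    have hpe : ∀ a, p a ⊆ e a := fun a => inter a ▸ Finset.inter_subset_left
    have hpf : ∀ a, p a ⊆ f a := fun a => inter a ▸ Finset.inter_subset_right
    obtain ⟨a, h | h⟩ := hmix ord (fun x hx y hy hxy =>
      hord (Finset.mem_coe.2 ((mem_verts x).2 hx)) (Finset.mem_coe.2 ((mem_verts y).2 hy)) hxy)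
    · refine ⟨f a, edge_f a, e a, edge_e a, p a, ⟨hpf a, card_p a, ?_⟩, ⟨hpe a, card_p a, ?_⟩⟩
      · intro u hu v hv hvp
        obtain ⟨i, rfl⟩ := p_range a u hu
        obtain ⟨j, rfl⟩ := f_range a v hv
        rw [mem_p] at hu hvp
        rw [mem_f] at hv
        exact h (Fin.lt_def.2 (by omega))
      · intro u hu v hv hvp
        obtain ⟨i, rfl⟩ := p_range a u hu
        obtain ⟨j, rfl⟩ := e_range a v hv
        rw [mem_p] at hu hvp
        rw [mem_e] at hv
        exact h (Fin.lt_def.2 (by omega))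
    · refine ⟨e a, edge_e a, f a, edge_f a, p a, ⟨hpe a, card_p a, ?_⟩, ⟨hpf a, card_p a, ?_⟩⟩
      · intro u hu v hv hvp
        obtain ⟨i, rfl⟩ := p_range a u hu
        obtain ⟨j, rfl⟩ := e_range a v hv
        rw [mem_p] at hu hvp
        rw [mem_e] at hv
        exact h (Fin.lt_def.2 (by omega))
      · intro u hu v hv hvp
        obtain ⟨i, rfl⟩ := p_range a u hu
        obtain ⟨j, rfl⟩ := f_range a v hv
        rw [mem_p] at hu hvp
        rw [mem_f] at hv
        exact h (Fin.lt_def.2 (by omega))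
  · refine ⟨id, Set.injOn_id _, ?_⟩
    have sY : ∀ i : Fin (2 * r - 2), (i : ℕ) < r ↔ headTailSeq r i ≠ Letter.Y := by
      intro i
      unfold headTailSeq
      split_ifs <;> simp <;> omega
    have sX : ∀ i : Fin (2 * r - 2), r - 2 ≤ (i : ℕ) ↔ headTailSeq r i ≠ Letter.X := by
      intro i
      unfold headTailSeq
      split_ifs <;> simp <;> omega
    have cover : ∀ a v, (v ∈ e a ∨ v ∈ f a) ↔ ∃ i, w a i = v := by
      intro a v
      constructor
      · rintro (h | h)
        exacts [e_range a v h, f_range a v h]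
      · rintro ⟨i, rfl⟩
        rw [mem_e, mem_f]
        omega
    rintro s t ⟨hs, ht, hst, hc⟩
    obtain ⟨a, ha⟩ := (mem_edges s).1 hs
    obtain ⟨b, hb⟩ := (mem_edges t).1 ht
    have hab : a = b := by
      by_contra hab
      have := small a b hab s t ha hb
      omega
    subst hab
    rcases ha with rfl | rfl <;> rcases hb with rfl | rfl
    · exact absurd rfl hst
    · refine ⟨w a, fun i j hij => hw a hij, fun v => ?_, Or.inl ⟨fun i => ?_, fun i => ?_⟩⟩
      · rw [Finset.mem_union, cover]
      · rw [mem_e, sY]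
      · rw [mem_f, sX]
    · refine ⟨w a, fun i j hij => hw a hij, fun v => ?_, Or.inr ⟨fun i => ?_, fun i => ?_⟩⟩
      · rw [Finset.mem_union, or_comm, cover]
      · rw [mem_f, sX]
      · rw [mem_e, sY]
    · exact absurd rfl hst

theorem exists_choice {Λ C G : Type} [Fintype Λ] [Fintype C] [Fintype G]
    (good : G → Λ → C → Prop) (hgood : ∀ g l, ∃ c, good g l c)
    (hcard : Fintype.card G * (Fintype.card C - 1) ^ Fintype.card Λ
      < Fintype.card C ^ Fintype.card Λ) :
    ∃ f : Λ → C, ∀ g, ∃ l, good g l (f l) := by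
  classical
  choose c hc using hgood
  by_contra! hcon
  have hsub : (Finset.univ : Finset (Λ → C)) ⊆ Finset.univ.biUnion
      (fun g => Fintype.piFinset (fun l => Finset.univ.erase (c g l))) := by
    intro f _
    obtain ⟨g, hg⟩ := hcon f
    simp only [Finset.mem_biUnion, Finset.mem_univ, true_and, Fintype.mem_piFinset,
      Finset.mem_erase, and_true]
    exact ⟨g, fun l h => hg l (h ▸ hc g l)⟩
  have h1 := (Finset.card_le_card hsub).trans Finset.card_biUnion_le
  simp [Fintype.card_piFinset] at h1
  omega

theorem exists_mono {α : Type} [LinearOrder α] (f : α → ℕ) (hf : Function.Injective f) (n : ℕ) :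
    ∀ (a b : ℕ), a + b = n → ∀ S : Finset α, 2 ^ n ≤ S.card →
      (∃ t : Finset α, t ⊆ S ∧ t.card = a ∧ StrictMonoOn f t) ∨
      (∃ t : Finset α, t ⊆ S ∧ t.card = b ∧ StrictAntiOn f t) := by
  classical
  induction n with
  | zero =>
    intro a b hab S _
    exact Or.inl ⟨∅, by simp, by simp; omega, by simp [StrictMonoOn]⟩
  | succ n ih =>
    intro a b hab S hS
    rcases a with _ | a
    · exact Or.inl ⟨∅, by simp, by simp, by simp [StrictMonoOn]⟩
    rcases b with _ | b
    · exact Or.inr ⟨∅, by simp, by simp, by simp [StrictAntiOn]⟩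
    have hne : S.Nonempty := by
      rw [← Finset.card_pos]
      exact lt_of_lt_of_le (by positivity) hS
    set x := S.min' hne with hx
    have hxS : x ∈ S := S.min'_mem hne
    have hcard : (S.erase x).card + 1 = S.card := Finset.card_erase_add_one hxS
    have hsplit := Finset.card_filter_add_card_filter_not (s := S.erase x) (fun y => f x < f y)
    have h2 : 2 ^ (n + 1) = 2 ^ n + 2 ^ n := by ring
    have hlt : ∀ y ∈ S.erase x, x < y := by
      intro y hy
      rw [Finset.mem_erase] at hy
      exact lt_of_le_of_ne (S.min'_le y hy.2) hy.1.symm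
    by_cases hU : 2 ^ n ≤ ((S.erase x).filter (fun y => f x < f y)).card
    · rcases ih a (b + 1) (by omega) _ hU with ⟨t, ht, hc, hm⟩ | ⟨t, ht, hc, hm⟩
      · left
        have ht' : ∀ y ∈ t, y ∈ S ∧ x < y ∧ f x < f y := by
          intro y hy
          have := Finset.mem_filter.1 (ht hy)
          exact ⟨Finset.mem_of_mem_erase this.1, hlt y this.1, this.2⟩
        have hxt : x ∉ t := fun h => lt_irrefl _ (ht' x h).2.1
        refine ⟨insert x t, ?_, by rw [Finset.card_insert_of_notMem hxt, hc], ?_⟩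
        · intro y hy
          rcases Finset.mem_insert.1 hy with rfl | hy
          exacts [hxS, (ht' y hy).1]
        · intro y hy z hz hyz
          rcases Finset.mem_insert.1 (Finset.mem_coe.1 hy) with hy | hy <;>
            rcases Finset.mem_insert.1 (Finset.mem_coe.1 hz) with hz | hz
          · rw [hy, hz] at hyz
            exact absurd hyz (lt_irrefl _)
          · rw [hy]
            exact (ht' z hz).2.2
          · rw [hz] at hyz
            exact absurd (hyz.trans (ht' y hy).2.1) (lt_irrefl _)
          · exact hm hy hz hyz
      · right
        exact ⟨t, fun y hy => Finset.mem_of_mem_erase (Finset.mem_filter.1 (ht hy)).1, hc, hm⟩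
    · have hD : 2 ^ n ≤ ((S.erase x).filter (fun y => ¬ f x < f y)).card := by omega
      rcases ih (a + 1) b (by omega) _ hD with ⟨t, ht, hc, hm⟩ | ⟨t, ht, hc, hm⟩
      · left
        exact ⟨t, fun y hy => Finset.mem_of_mem_erase (Finset.mem_filter.1 (ht hy)).1, hc, hm⟩
      · right
        have ht' : ∀ y ∈ t, y ∈ S ∧ x < y ∧ f y < f x := by
          intro y hy
          have := Finset.mem_filter.1 (ht hy)
          have hxy := hlt y this.1
          exact ⟨Finset.mem_of_mem_erase this.1, hxy,
            lt_of_le_of_ne (not_lt.1 this.2) (fun h => hxy.ne' (hf h))⟩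
        have hxt : x ∉ t := fun h => lt_irrefl _ (ht' x h).2.1
        refine ⟨insert x t, ?_, by rw [Finset.card_insert_of_notMem hxt, hc], ?_⟩
        · intro y hy
          rcases Finset.mem_insert.1 hy with rfl | hy
          exacts [hxS, (ht' y hy).1]
        · intro y hy z hz hyz
          rcases Finset.mem_insert.1 (Finset.mem_coe.1 hy) with hy | hy <;>
            rcases Finset.mem_insert.1 (Finset.mem_coe.1 hz) with hz | hz
          · rw [hy, hz] at hyz
            exact absurd hyz (lt_irrefl _)
          · rw [hy]
            exact (ht' z hz).2.2
          · rw [hz] at hyz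
            exact absurd (hyz.trans (ht' y hy).2.1) (lt_irrefl _)
          · exact hm hy hz hyz

theorem exists_mono_fin (k m : ℕ) (hm : 2 ^ (k + k) ≤ m) (f : Fin m → ℕ)
    (hf : Function.Injective f) :
    ∃ s : Fin k → Fin m, StrictMono s ∧ (StrictMono (f ∘ s) ∨ StrictAnti (f ∘ s)) := by
  rcases exists_mono f hf (k + k) k k rfl Finset.univ (by simpa using hm) with
    ⟨t, -, hc, h⟩ | ⟨t, -, hc, h⟩
  · refine ⟨t.orderEmbOfFin hc, (t.orderEmbOfFin hc).strictMono, Or.inl fun i j hij => ?_⟩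
    exact h (t.orderEmbOfFin_mem hc i) (t.orderEmbOfFin_mem hc j)
      ((t.orderEmbOfFin hc).strictMono hij)
  · refine ⟨t.orderEmbOfFin hc, (t.orderEmbOfFin hc).strictMono, Or.inr fun i j hij => ?_⟩
    exact h (t.orderEmbOfFin_mem hc i) (t.orderEmbOfFin_mem hc j)
      ((t.orderEmbOfFin hc).strictMono hij)

theorem exists_rank {α : Type} [Fintype α] (h : α → ℕ) :
    ∃ g : α → Fin (Fintype.card α), ∀ u v, g u < g v ↔ h u < h v := by
  classical
  have hmono : ∀ u v, h u ≤ h v → (Finset.univ.filter (fun x => h x < h u)).card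
      ≤ (Finset.univ.filter (fun x => h x < h v)).card := by
    intro u v huv
    apply Finset.card_le_card
    intro x hx
    simp only [Finset.mem_filter, Finset.mem_univ, true_and] at hx ⊢
    omega
  refine ⟨fun u => ⟨(Finset.univ.filter (fun x => h x < h u)).card, ?_⟩, ?_⟩
  · apply Finset.card_lt_univ_of_notMem (x := u)
    simp
  · intro u v
    rw [Fin.mk_lt_mk]
    constructor
    · intro hlt
      by_contra hcon
      have := hmono v u (by omega)
      omega
    · intro huv
      apply Finset.card_lt_card
      rw [Finset.ssubset_iff_of_subset]
      · exact ⟨u, by simpa using huv, by simp⟩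
      · intro x hx
        simp only [Finset.mem_filter, Finset.mem_univ, true_and] at hx ⊢
        omega

theorem exists_large_prime (m B : ℕ) (hm : 0 < m) (hB : 0 < B) :
    ∃ p : ℕ, p.Prime ∧ m ≤ p ∧ (m * p) ^ (m * p) * (B - 1) ^ (p * p) < B ^ (p * p) := by
  have hB' : (0 : ℝ) < B := by exact_mod_cast hB
  have hm' : (0 : ℝ) < m := by exact_mod_cast hm
  have hB1 : (1 : ℝ) ≤ B := by exact_mod_cast hB
  have habs : |((B : ℝ) - 1) / B| < 1 := by
    rw [abs_of_nonneg (div_nonneg (by linarith) hB'.le), div_lt_one hB']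
    linarith
  have ht := tendsto_pow_const_mul_const_pow_of_abs_lt_one m habs
  have hev := ht.eventually_lt_const (show (0 : ℝ) < 1 / (m : ℝ) ^ m by positivity)
  obtain ⟨N, hN⟩ := Filter.eventually_atTop.1 hev
  obtain ⟨p, hp, hprime⟩ := Nat.exists_infinite_primes (N + m)
  refine ⟨p, hprime, by omega, ?_⟩
  have h := hN p (by omega)
  have hreal : ((m : ℝ) * p) ^ m * ((B : ℝ) - 1) ^ p < (B : ℝ) ^ p := by
    rw [div_pow, lt_div_iff₀ (by positivity), ← mul_div_assoc, div_mul_eq_mul_div,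
      div_lt_one (by positivity)] at h
    calc ((m : ℝ) * p) ^ m * ((B : ℝ) - 1) ^ p = (p : ℝ) ^ m * ((B : ℝ) - 1) ^ p * (m : ℝ) ^ m := by
          rw [mul_pow]; ring
      _ < _ := h
  have hnat : (m * p) ^ m * (B - 1) ^ p < B ^ p := by
    have : (((m * p) ^ m * (B - 1) ^ p : ℕ) : ℝ) < ((B ^ p : ℕ) : ℝ) := by
      push_cast [Nat.cast_sub hB]
      exact hreal
    exact_mod_cast this
  calc (m * p) ^ (m * p) * (B - 1) ^ (p * p) = ((m * p) ^ m * (B - 1) ^ p) ^ p := by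
        rw [mul_pow (_ ^ m), ← pow_mul, ← pow_mul]
    _ < (B ^ p) ^ p := Nat.pow_lt_pow_left hnat hprime.ne_zero
    _ = _ := by rw [← pow_mul]

theorem exists_tuples (k : ℕ) : ∃ (ι : Type) (_ : Fintype ι) (w : ι → Fin k → ℕ),
    (∀ a, StrictMono (w a)) ∧
    (∀ a b, a ≠ b → ∀ i j i' j', w a i = w b i' → w a j = w b j' → i = j) ∧
    (∀ ord : ℕ → ℕ, Set.InjOn ord {v | ∃ a i, w a i = v} →
      ∃ a, StrictMono (fun i => ord (w a i)) ∨ StrictAnti (fun i => ord (w a i))) := by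
  classical
  let m := 2 ^ (k + k)
  have hmpos : 0 < m := by positivity
  let C := {s : Fin k → Fin m // StrictMono s}
  have hCne : Nonempty C := by
    obtain ⟨s, hs, -⟩ := exists_mono_fin k m le_rfl (fun i => (i : ℕ)) Fin.val_injective
    exact ⟨⟨s, hs⟩⟩
  obtain ⟨p, hprime, hmp, hcount⟩ := exists_large_prime m (Fintype.card C) hmpos Fintype.card_pos
  haveI : Fact p.Prime := ⟨hprime⟩
  let V := Fin m × ZMod p
  have hV : Fintype.card V = m * p := by simp [V, ZMod.card]
  let line : ZMod p × ZMod p → Fin m → V := fun l i => (i, l.1 + l.2 * ((i : ℕ) : ZMod p))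
  let pt : V → ℕ := fun v => (v.1 : ℕ) * p + v.2.val
  have hptlt : ∀ u v : V, u.1 < v.1 → pt u < pt v := by
    intro u v huv
    have h1 : (u.1 : ℕ) + 1 ≤ v.1 := huv
    have h2 : u.2.val < p := ZMod.val_lt u.2
    have h3 := Nat.mul_le_mul_right p h1
    simp only [pt]
    rw [Nat.add_mul] at h3
    omega
  have hptinj : Function.Injective pt := by
    intro u v huv
    have h1 : u.1 = v.1 := by
      rcases lt_trichotomy u.1 v.1 with h | h | h
      · have := hptlt u v h
        omega
      · exact h
      · have := hptlt v u h
        omega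
    have h2 : u.2.val = v.2.val := by
      simp only [pt, h1] at huv
      omega
    exact Prod.ext h1 (ZMod.val_injective p h2)
  let good : (V → Fin (Fintype.card V)) → ZMod p × ZMod p → C → Prop := fun g l c =>
    Function.Injective g → (StrictMono (fun j => g (line l (c.1 j))) ∨
      StrictAnti (fun j => g (line l (c.1 j))))
  have hlineinj : ∀ l, Function.Injective (line l) := fun l i j h => congrArg Prod.fst h
  obtain ⟨c, hc⟩ := exists_choice good (by
      intro g l
      by_cases hg : Function.Injective g
      · obtain ⟨s, hs, h⟩ := exists_mono_fin k m le_rfl (fun i => (g (line l i) : ℕ))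
          (Fin.val_injective.comp (hg.comp (hlineinj l)))
        exact ⟨⟨s, hs⟩, fun _ => h⟩
      · exact ⟨Classical.choice hCne, fun h => absurd h hg⟩) (by
      rw [Fintype.card_fun, Fintype.card_fin, hV, Fintype.card_prod, ZMod.card]
      exact hcount)
  refine ⟨ZMod p × ZMod p, inferInstance, fun l j => pt (line l ((c l).1 j)), ?_, ?_, ?_⟩
  · intro l i j hij
    exact hptlt _ _ ((c l).2 hij)
  · intro a b hab i j i' j' hi hj
    have hi := hptinj hi
    have hj := hptinj hj
    have hi1 : (c a).1 i = (c b).1 i' := congrArg Prod.fst hi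
    have hj1 : (c a).1 j = (c b).1 j' := congrArg Prod.fst hj
    have hi2 := congrArg Prod.snd hi
    have hj2 := congrArg Prod.snd hj
    simp only [line, ← hi1, ← hj1] at hi2 hj2
    apply (c a).2.injective
    by_contra hne
    have hxy : ((((c a).1 i : Fin m) : ℕ) : ZMod p) - ((((c a).1 j : Fin m) : ℕ) : ZMod p) ≠ 0 := by
      intro h
      have h := sub_eq_zero.1 h
      rw [ZMod.natCast_eq_natCast_iff', Nat.mod_eq_of_lt (lt_of_lt_of_le (Fin.is_lt _) hmp),
        Nat.mod_eq_of_lt (lt_of_lt_of_le (Fin.is_lt _) hmp)] at h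
      exact hne (Fin.ext h)
    have hmul : (a.2 - b.2) * (((((c a).1 i : Fin m) : ℕ) : ZMod p)
        - ((((c a).1 j : Fin m) : ℕ) : ZMod p)) = 0 := by
      linear_combination hi2 - hj2
    have h2 : a.2 = b.2 := sub_eq_zero.1 ((mul_eq_zero.1 hmul).resolve_right hxy)
    have h1 : a.1 = b.1 := by
      rw [h2] at hi2
      exact add_right_cancel hi2
    exact hab (Prod.ext h1 h2)
  · intro ord hord
    let S : Set ℕ := {v | ∃ (a : ZMod p × ZMod p) (i : Fin k), pt (line a ((c a).1 i)) = v}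
    let ord' : ℕ → ℕ := fun v => if v ∈ S then 2 * ord v else 2 * v + 1
    have hinj' : Function.Injective ord' := by
      intro u v huv
      simp only [ord'] at huv
      split_ifs at huv with h1 h2 h2
      · exact hord h1 h2 (by omega)
      · omega
      · omega
      · omega
    obtain ⟨g, hg⟩ := exists_rank (fun v : V => ord' (pt v))
    have hginj : Function.Injective g := by
      intro u v huv
      have h1 := hg u v
      have h2 := hg v u
      rw [huv] at h1 h2
      simp only [lt_irrefl, false_iff] at h1 h2
      exact hptinj (hinj' (by omega))
    obtain ⟨l, hl⟩ := hc g
    have key : ∀ i j, g (line l ((c l).1 i)) < g (line l ((c l).1 j)) →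
        ord (pt (line l ((c l).1 i))) < ord (pt (line l ((c l).1 j))) := by
      intro i j h
      have h := (hg _ _).1 h
      have hi : pt (line l ((c l).1 i)) ∈ S := ⟨l, i, rfl⟩
      have hj : pt (line l ((c l).1 j)) ∈ S := ⟨l, j, rfl⟩
      simp only [ord', if_pos hi, if_pos hj] at h
      omega
    refine ⟨l, ?_⟩
    rcases hl hginj with h | h
    · exact Or.inl fun i j hij => key _ _ (h hij)
    · exact Or.inr fun i j hij => key _ _ (h hij)

/-- existence of a quasi-linear, head-tail-mixing r-graph admitting
the descriptive sequence `XX…XZZYY…Y`. -/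
theorem exists_quasiLinear_headTailMixing (r : ℕ) (hr : 3 ≤ r) :
    ∃ F : RGraph r, QuasiLinear F ∧ HeadTailMixing F ∧ AdmitsSeq F (headTailSeq r) := by
  obtain ⟨ι, hι, w, h1, h2, h3⟩ := exists_tuples (2 * r - 2)
  exact of_tuples r hr w h1 h2 h3

end UTD
end

section
/- For every integer r ≥ 3 and every δ > 0 there exists n_0 such that for every n ≥ n_0 there exists an r-graph H on the vertex set [n] = {1,…,n} which is (1/4,δ)-dense and in which no pair of vertices is both the head of some edge and the tail of another edge, where heads and tails are taken with respect to the natural order on [n]. In particular, for every r ≥ 3 there exists a locally 1/4-dense sequence of r-graphs each of which contains no pair of vertices that is simultaneously the head of one edge and the tail of another. -/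
namespace UTD

/-- Walsh sign matrix on `k` bits: `(-1)` to the number of common binary digits. -/
noncomputable def walsh : ℕ → ℕ → ℕ → ℝ
  | 0, _, _ => 1
  | k + 1, a, b => (if a % 2 = 1 ∧ b % 2 = 1 then -1 else 1) * walsh k (a / 2) (b / 2)

/-- Bound on the prefix correlations of two Walsh rows. -/
noncomputable def corr : ℕ → ℕ → ℕ → ℝ
  | 0, _, _ => 1
  | k + 1, a, b => if a % 2 = b % 2 then 2 * corr k (a / 2) (b / 2) + 1 else 1

theorem walsh_symm (k a b : ℕ) : walsh k a b = walsh k b a := by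
  induction k generalizing a b with
  | zero => rfl
  | succ k ih => simp only [walsh, ih (a / 2), and_comm]

theorem walsh_cases (k a b : ℕ) : walsh k a b = 1 ∨ walsh k a b = -1 := by
  induction k generalizing a b with
  | zero => left; rfl
  | succ k ih =>
    simp only [walsh]
    split_ifs <;> rcases ih (a / 2) (b / 2) with h | h <;> simp [h]

theorem walsh_abs (k a b : ℕ) : |walsh k a b| = 1 := by
  rcases walsh_cases k a b with h | h <;> simp [h]

theorem corr_nonneg (k a b : ℕ) : 0 ≤ corr k a b := by
  induction k generalizing a b with
  | zero => simp [corr]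
  | succ k ih =>
    simp only [corr]
    have := ih (a / 2) (b / 2)
    split_ifs <;> linarith

theorem sum_range_two_mul (g : ℕ → ℝ) (n : ℕ) :
    ∑ a ∈ Finset.range (2 * n), g a = ∑ a ∈ Finset.range n, (g (2 * a) + g (2 * a + 1)) := by
  induction n with
  | zero => simp
  | succ n ih =>
    rw [show 2 * (n + 1) = 2 * n + 1 + 1 by ring, Finset.sum_range_succ, Finset.sum_range_succ,
      Finset.sum_range_succ, ih]
    ring

theorem sum_corr (k : ℕ) :
    ∑ a ∈ Finset.range (2 ^ k), ∑ b ∈ Finset.range (2 ^ k), corr k a b = (k + 1) * 4 ^ k := by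
  induction k with
  | zero => simp [corr]
  | succ k ih =>
    rw [pow_succ', sum_range_two_mul]
    simp only [sum_range_two_mul]
    have e1 : ∀ x : ℕ, (2 * x + 1) / 2 = x := fun x => by omega
    have e2 : ∀ x : ℕ, (2 * x) / 2 = x := fun x => by omega
    have e3 : ∀ x : ℕ, (2 * x + 1) % 2 = 1 := fun x => by omega
    have e4 : ∀ x : ℕ, (2 * x) % 2 = 0 := fun x => by omega
    have : ∀ x ∈ Finset.range (2 ^ k),
        ((∑ a ∈ Finset.range (2 ^ k), (corr (k + 1) (2 * x) (2 * a) +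
          corr (k + 1) (2 * x) (2 * a + 1))) +
        ∑ a ∈ Finset.range (2 ^ k), (corr (k + 1) (2 * x + 1) (2 * a) +
          corr (k + 1) (2 * x + 1) (2 * a + 1))) =
        4 * (∑ a ∈ Finset.range (2 ^ k), corr k x a) + 4 * 2 ^ k := by
      intro x _
      simp only [corr, e1, e2, e3, e4]
      simp [Finset.sum_add_distrib, ← Finset.mul_sum]
      ring
    rw [Finset.sum_congr rfl this, Finset.sum_add_distrib, ← Finset.mul_sum, ih]
    simp
    have : (4 : ℝ) ^ k = 2 ^ k * 2 ^ k := by rw [← mul_pow]; norm_num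
    rw [pow_succ, this]
    ring

theorem prefix_le (k a b M : ℕ) (hM : M ≤ 2 ^ k) :
    |∑ x ∈ Finset.range M, walsh k a x * walsh k b x| ≤ corr k a b := by
  induction k generalizing a b M with
  | zero =>
    have : M = 0 ∨ M = 1 := by simp at hM; omega
    rcases this with rfl | rfl <;> simp [walsh, corr]
  | succ k ih =>
    have e1 : ∀ x : ℕ, (2 * x + 1) / 2 = x := fun x => by omega
    have e2 : ∀ x : ℕ, (2 * x) / 2 = x := fun x => by omega
    have e3 : ∀ x : ℕ, (2 * x + 1) % 2 = 1 := fun x => by omega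
    have e4 : ∀ x : ℕ, (2 * x) % 2 = 0 := fun x => by omega
    have heven : ∀ m, m ≤ 2 ^ k →
        |∑ x ∈ Finset.range (2 * m), walsh (k + 1) a x * walsh (k + 1) b x| ≤
          corr (k + 1) a b - 1 := by
      intro m hm
      rw [sum_range_two_mul]
      simp only [walsh, corr, e1, e2, e3, e4]
      by_cases h : a % 2 = b % 2
      · have := ih (a / 2) (b / 2) m hm
        have h2 : ∀ x ∈ Finset.range m,
          ((if a % 2 = 1 ∧ 0 = 1 then -1 else 1) * walsh k (a / 2) x *
            ((if b % 2 = 1 ∧ 0 = 1 then -1 else 1) * walsh k (b / 2) x) +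
          (if a % 2 = 1 ∧ True then -1 else 1) * walsh k (a / 2) x *
            ((if b % 2 = 1 ∧ True then -1 else 1) * walsh k (b / 2) x))
          = 2 * (walsh k (a / 2) x * walsh k (b / 2) x) := by
          intro x _
          rw [h]
          rcases Nat.mod_two_eq_zero_or_one b with hb | hb <;> simp [hb] <;> ring
        rw [Finset.sum_congr rfl h2, ← Finset.mul_sum, abs_mul, if_pos h]
        simp only [abs_two]
        linarith
      · rw [if_neg h, Finset.sum_eq_zero]
        · simp
        · intro x _
          rcases Nat.mod_two_eq_zero_or_one a with ha | ha <;>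
          rcases Nat.mod_two_eq_zero_or_one b with hb | hb <;> simp [ha, hb] at h ⊢
    rw [pow_succ] at hM
    rcases Nat.even_or_odd' M with ⟨m, rfl | rfl⟩
    · have := heven m (by omega)
      linarith
    · have := heven m (by omega)
      rw [Finset.sum_range_succ]
      refine (abs_add_le _ _).trans ?_
      rw [abs_mul, walsh_abs, walsh_abs]
      linarith

theorem deg_bound (k : ℕ) (R : ℕ → ℕ → Prop) [DecidableRel R] (S : Finset ℕ)
    (hS : S ⊆ Finset.range (2 ^ k))
    (hR : ∀ a < 2 ^ k, ∀ b < 2 ^ k,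
      |∑ x ∈ (Finset.range (2 ^ k)).filter (fun x => R a x ∧ R b x), walsh k a x * walsh k b x|
        ≤ 2 * corr k a b) :
    (∑ x ∈ S, |∑ a ∈ S.filter (fun a => R a x), walsh k a x|) ^ 2 ≤
      2 ^ k * (2 * ((k + 1) * 4 ^ k)) := by
  have hsub : (∑ x ∈ S, |∑ a ∈ S.filter (fun a => R a x), walsh k a x|) ≤
      ∑ x ∈ Finset.range (2 ^ k), |∑ a ∈ S.filter (fun a => R a x), walsh k a x| :=
    Finset.sum_le_sum_of_subset_of_nonneg hS (fun _ _ _ => abs_nonneg _)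
  have h0 : 0 ≤ (∑ x ∈ S, |∑ a ∈ S.filter (fun a => R a x), walsh k a x|) :=
    Finset.sum_nonneg (fun _ _ => abs_nonneg _)
  refine (pow_le_pow_left₀ h0 hsub 2).trans ?_
  refine sq_sum_le_card_mul_sum_sq.trans ?_
  rw [Finset.card_range]
  push_cast
  refine mul_le_mul_of_nonneg_left ?_ (by positivity)
  have hexp : ∑ x ∈ Finset.range (2 ^ k), |∑ a ∈ S.filter (fun a => R a x), walsh k a x| ^ 2 =
      ∑ a ∈ S, ∑ b ∈ S, ∑ x ∈ (Finset.range (2 ^ k)).filter (fun x => R a x ∧ R b x),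
        walsh k a x * walsh k b x := by
    simp only [sq_abs]
    simp only [sq, Finset.sum_filter, Finset.sum_mul_sum]
    rw [Finset.sum_comm]
    refine Finset.sum_congr rfl fun a _ => ?_
    rw [Finset.sum_comm]
    refine Finset.sum_congr rfl fun b _ => ?_
    refine Finset.sum_congr rfl fun x _ => ?_
    by_cases h1 : R a x <;> by_cases h2 : R b x <;> simp [h1, h2]
  rw [hexp, ← sum_corr, Finset.mul_sum]
  have hlt : ∀ a ∈ S, a < 2 ^ k := fun a ha => Finset.mem_range.1 (hS ha)
  calc _ ≤ ∑ a ∈ S, ∑ b ∈ S, 2 * corr k a b :=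
        Finset.sum_le_sum fun a ha => Finset.sum_le_sum fun b hb =>
          (le_abs_self _).trans (hR a (hlt a ha) b (hlt b hb))
    _ ≤ ∑ a ∈ S, ∑ b ∈ Finset.range (2 ^ k), 2 * corr k a b :=
        Finset.sum_le_sum fun a ha => Finset.sum_le_sum_of_subset_of_nonneg hS
          fun b _ _ => mul_nonneg (by norm_num) (corr_nonneg k a b)
    _ ≤ ∑ a ∈ Finset.range (2 ^ k), ∑ b ∈ Finset.range (2 ^ k), 2 * corr k a b :=
        Finset.sum_le_sum_of_subset_of_nonneg hS fun a _ _ =>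
          Finset.sum_nonneg fun b _ => mul_nonneg (by norm_num) (corr_nonneg k a b)
    _ = _ := by simp only [Finset.mul_sum]

theorem deg_bound_gt (k : ℕ) (S : Finset ℕ) (hS : S ⊆ Finset.range (2 ^ k)) :
    (∑ x ∈ S, |∑ a ∈ S.filter (fun a => a > x), walsh k a x|) ^ 2 ≤
      2 ^ k * (2 * ((k + 1) * 4 ^ k)) := by
  refine deg_bound k (fun a x => a > x) S hS ?_
  intro a ha b hb
  have : (Finset.range (2 ^ k)).filter (fun x => a > x ∧ b > x) = Finset.range (min a b) := by
    ext x; simp; omega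
  rw [this]
  have h := prefix_le k a b (min a b) (by omega)
  have := corr_nonneg k a b
  linarith

theorem deg_bound_lt (k : ℕ) (S : Finset ℕ) (hS : S ⊆ Finset.range (2 ^ k)) :
    (∑ x ∈ S, |∑ a ∈ S.filter (fun a => a < x), walsh k a x|) ^ 2 ≤
      2 ^ k * (2 * ((k + 1) * 4 ^ k)) := by
  refine deg_bound k (fun a x => a < x) S hS ?_
  intro a ha b hb
  have : (Finset.range (2 ^ k)).filter (fun x => a < x ∧ b < x) =
      Finset.range (2 ^ k) \ Finset.range (max a b + 1) := by
    ext x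
    simp only [Finset.mem_filter, Finset.mem_range, Finset.mem_sdiff]
    omega
  rw [this]
  have hs := Finset.sum_sdiff (f := fun x => walsh k a x * walsh k b x)
    (Finset.range_subset_range.2 (show max a b + 1 ≤ 2 ^ k by omega))
  have h1 := abs_le.1 (prefix_le k a b (max a b + 1) (by omega))
  have h2 := abs_le.1 (prefix_le k a b (2 ^ k) le_rfl)
  rw [abs_le]
  constructor <;> linarith [h1.1, h1.2, h2.1, h2.2]

/-- Abstract minimum/maximum selector for finite sets. -/
structure IsSel (m : Finset ℕ → ℕ) (R : ℕ → ℕ → Prop) : Prop where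
  mem : ∀ T : Finset ℕ, T.Nonempty → m T ∈ T
  ins : ∀ (T : Finset ℕ) (a : ℕ), T.Nonempty → ((a ∉ T ∧ m (insert a T) = a) ↔ R a (m T))

theorem sum_sel {m : Finset ℕ → ℕ} {R : ℕ → ℕ → Prop} [DecidableRel R] (h : IsSel m R)
    (S : Finset ℕ) (k : ℕ) (hk : 1 ≤ k) (g : Finset ℕ → ℝ) :
    ∑ e ∈ S.powersetCard (k + 1), g e =
      ∑ T ∈ S.powersetCard k, ∑ a ∈ S.filter (fun a => R a (m T)), g (insert a T) := by
  rw [Finset.sum_sigma']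
  refine Finset.sum_bij' (fun e _ => ⟨e.erase (m e), m e⟩) (fun p _ => insert p.2 p.1)
    ?_ ?_ ?_ ?_ ?_
  · intro e he
    rw [Finset.mem_powersetCard] at he
    have hne : e.Nonempty := Finset.card_pos.1 (by omega)
    have hm := h.mem e hne
    have hc : (e.erase (m e)).card = k := by rw [Finset.card_erase_of_mem hm]; omega
    simp only [Finset.mem_sigma, Finset.mem_powersetCard, Finset.mem_filter]
    refine ⟨⟨(Finset.erase_subset _ _).trans he.1, hc⟩, he.1 hm, ?_⟩
    refine (h.ins _ _ (Finset.card_pos.1 (by omega))).1 ⟨Finset.notMem_erase _ _, ?_⟩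
    rw [Finset.insert_erase hm]
  · rintro ⟨T, a⟩ hp
    simp only [Finset.mem_sigma, Finset.mem_powersetCard, Finset.mem_filter] at hp ⊢
    obtain ⟨⟨hT, hc⟩, haS, haR⟩ := hp
    have := (h.ins T a (Finset.card_pos.1 (by omega))).2 haR
    refine ⟨Finset.insert_subset haS hT, ?_⟩
    rw [Finset.card_insert_of_notMem this.1, hc]
  · intro e he
    rw [Finset.mem_powersetCard] at he
    exact Finset.insert_erase (h.mem e (Finset.card_pos.1 (by omega)))
  · rintro ⟨T, a⟩ hp
    simp only [Finset.mem_sigma, Finset.mem_powersetCard, Finset.mem_filter] at hp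
    obtain ⟨⟨hT, hc⟩, haS, haR⟩ := hp
    have := (h.ins T a (Finset.card_pos.1 (by omega))).2 haR
    simp only [this.2, Finset.erase_insert this.1]
  · intro e he
    rw [Finset.mem_powersetCard] at he
    simp only [Finset.insert_erase (h.mem e (Finset.card_pos.1 (by omega)))]

theorem sum_sel_bound {m : Finset ℕ → ℕ} {R : ℕ → ℕ → Prop} [DecidableRel R] (h : IsSel m R)
    (S : Finset ℕ) (k : ℕ) (g u : Finset ℕ → ℝ) (F : ℕ → ℕ → ℝ)
    (hu : ∀ T, |u T| ≤ 1)
    (hg : ∀ T a, T.card = k + 1 → R a (m T) → g (insert a T) = F a (m T) * u T) :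
    |∑ e ∈ S.powersetCard (k + 2), g e| ≤
      (∑ b ∈ S, |∑ a ∈ S.filter (fun a => R a b), F a b|) * (S.card : ℝ) ^ k := by
  rw [sum_sel h S (k + 1) (by omega) g]
  have hmaps : ∀ T ∈ S.powersetCard (k + 1), m T ∈ S := by
    intro T hT
    rw [Finset.mem_powersetCard] at hT
    exact hT.1 (h.mem T (Finset.card_pos.1 (by omega)))
  calc _ ≤ ∑ T ∈ S.powersetCard (k + 1), |∑ a ∈ S.filter (fun a => R a (m T)), F a (m T)| := by
        refine (Finset.abs_sum_le_sum_abs _ _).trans (Finset.sum_le_sum fun T hT => ?_)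
        rw [Finset.mem_powersetCard] at hT
        have : ∑ a ∈ S.filter (fun a => R a (m T)), g (insert a T) =
            (∑ a ∈ S.filter (fun a => R a (m T)), F a (m T)) * u T := by
          rw [Finset.sum_mul]
          refine Finset.sum_congr rfl fun a ha => hg T a hT.2 (Finset.mem_filter.1 ha).2
        rw [this, abs_mul]
        exact mul_le_of_le_one_right (abs_nonneg _) (hu T)
    _ = ∑ b ∈ S, ∑ T ∈ (S.powersetCard (k + 1)).filter (fun T => m T = b),
          |∑ a ∈ S.filter (fun a => R a (m T)), F a (m T)| :=
        (Finset.sum_fiberwise_of_maps_to hmaps _).symm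
    _ = ∑ b ∈ S, (((S.powersetCard (k + 1)).filter (fun T => m T = b)).card : ℝ) *
          |∑ a ∈ S.filter (fun a => R a b), F a b| := by
        refine Finset.sum_congr rfl fun b _ => ?_
        rw [← nsmul_eq_mul, ← Finset.sum_const]
        refine Finset.sum_congr rfl fun T hT => ?_
        rw [(Finset.mem_filter.1 hT).2]
    _ ≤ _ := by
        rw [Finset.sum_mul]
        refine Finset.sum_le_sum fun b _ => ?_
        rw [mul_comm]
        refine mul_le_mul_of_nonneg_left ?_ (abs_nonneg _)
        have : ((S.powersetCard (k + 1)).filter (fun T => m T = b)).card ≤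
            (S.powersetCard k).card := by
          refine Finset.card_le_card_of_injOn (fun T => T.erase b) ?_ ?_
          · intro T hT
            simp only [Finset.coe_filter, Set.mem_ofPred_eq, Finset.mem_powersetCard] at hT
            obtain ⟨⟨h1, h2⟩, h3⟩ := hT
            have hb : b ∈ T := h3 ▸ h.mem T (Finset.card_pos.1 (by omega))
            simp only [Finset.mem_coe, Finset.mem_powersetCard]
            refine ⟨(Finset.erase_subset _ _).trans h1, ?_⟩
            rw [Finset.card_erase_of_mem hb]; omega
          · intro T hT T' hT' hEq
            simp only [Finset.coe_filter, Set.mem_ofPred_eq, Finset.mem_powersetCard] at hT hT'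
            have hb : b ∈ T := hT.2 ▸ h.mem T (Finset.card_pos.1 (by omega))
            have hb' : b ∈ T' := hT'.2 ▸ h.mem T' (Finset.card_pos.1 (by omega))
            rw [← Finset.insert_erase hb, ← Finset.insert_erase hb']
            exact congrArg (insert b) hEq
        rw [Finset.card_powersetCard] at this
        exact_mod_cast this.trans (Nat.choose_le_pow _ _)

/-- Minimum of a finite set. -/
noncomputable def mn (e : Finset ℕ) : ℕ := sInf (e : Set ℕ)

/-- Maximum of a finite set. -/
noncomputable def mx (e : Finset ℕ) : ℕ := e.sup id

theorem mn_eq {e : Finset ℕ} {x : ℕ} (hx : x ∈ e) (h : ∀ w ∈ e, x ≤ w) : mn e = x :=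
  le_antisymm (Nat.sInf_le (by exact_mod_cast hx))
    (h _ (by exact_mod_cast Nat.sInf_mem (s := (e : Set ℕ)) ⟨x, by exact_mod_cast hx⟩))

theorem mx_eq {e : Finset ℕ} {x : ℕ} (hx : x ∈ e) (h : ∀ w ∈ e, w ≤ x) : mx e = x :=
  le_antisymm (Finset.sup_le h) (Finset.le_sup (f := id) hx)

theorem mn_mem {e : Finset ℕ} (h : e.Nonempty) : mn e ∈ e := by
  exact_mod_cast Nat.sInf_mem (s := (e : Set ℕ)) (by exact_mod_cast h)

theorem mn_le {e : Finset ℕ} {x : ℕ} (hx : x ∈ e) : mn e ≤ x :=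
  Nat.sInf_le (by exact_mod_cast hx)

theorem le_mx {e : Finset ℕ} {x : ℕ} (hx : x ∈ e) : x ≤ mx e := Finset.le_sup (f := id) hx

theorem mx_mem {e : Finset ℕ} (h : e.Nonempty) : mx e ∈ e := by
  obtain ⟨i, hi, he⟩ := Finset.exists_mem_eq_sup e h id
  have : mx e = i := he
  rwa [this]

theorem sel_mn : IsSel mn (fun a b => a < b) where
  mem := fun _ h => mn_mem h
  ins := by
    intro T a hT
    constructor
    · rintro ⟨h1, h2⟩
      have h3 : mn (insert a T) ≤ mn T := mn_le (Finset.mem_insert_of_mem (mn_mem hT))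
      have h4 : a ≠ mn T := fun h => h1 (h ▸ mn_mem hT)
      omega
    · intro h
      refine ⟨fun ha => absurd (mn_le ha) (by omega), mn_eq (Finset.mem_insert_self _ _) ?_⟩
      intro w hw
      rcases Finset.mem_insert.1 hw with rfl | hw
      · exact le_rfl
      · have := mn_le hw; omega

theorem sel_mx : IsSel mx (fun a b => a > b) where
  mem := fun _ h => mx_mem h
  ins := by
    intro T a hT
    constructor
    · rintro ⟨h1, h2⟩
      have h3 : mx T ≤ mx (insert a T) := le_mx (Finset.mem_insert_of_mem (mx_mem hT))
      have h4 : a ≠ mx T := fun h => h1 (h ▸ mx_mem hT)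
      show mx T < a
      omega
    · intro h
      have h : mx T < a := h
      refine ⟨fun ha => absurd (le_mx ha) (by omega), mx_eq (Finset.mem_insert_self _ _) ?_⟩
      intro w hw
      rcases Finset.mem_insert.1 hw with rfl | hw
      · exact le_rfl
      · have := le_mx hw; omega

/-- Sign of the head of `e`. -/
noncomputable def hd (k : ℕ) (e : Finset ℕ) : ℝ := walsh k (mn e) (mn (e.erase (mn e)))

/-- Sign of the tail of `e`. -/
noncomputable def tl (k : ℕ) (e : Finset ℕ) : ℝ := walsh k (mx e) (mx (e.erase (mx e)))

theorem hd_of_isHead (k : ℕ) {e : Finset ℕ} {x y : ℕ} (hxy : x < y)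
    (h : IsHead id e {x, y}) : hd k e = walsh k x y := by
  obtain ⟨h1, -, h3⟩ := h
  have hx : x ∈ e := h1 (by simp)
  have hy : y ∈ e := h1 (by simp)
  have e1 : mn e = x := by
    refine mn_eq hx fun w hw => ?_
    by_cases hp : w ∈ ({x, y} : Finset ℕ)
    · simp at hp; omega
    · exact (h3 x (by simp) w hw hp).le
  have e2 : mn (e.erase x) = y := by
    refine mn_eq (Finset.mem_erase.2 ⟨by omega, hy⟩) fun w hw => ?_
    obtain ⟨hwx, hw⟩ := Finset.mem_erase.1 hw
    by_cases hp : w ∈ ({x, y} : Finset ℕ)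
    · simp at hp; omega
    · exact (h3 y (by simp) w hw hp).le
  rw [hd, e1, e2]

theorem tl_of_isTail (k : ℕ) {e : Finset ℕ} {x y : ℕ} (hxy : x < y)
    (h : IsTail id e {x, y}) : tl k e = walsh k x y := by
  obtain ⟨h1, -, h3⟩ := h
  have hx : x ∈ e := h1 (by simp)
  have hy : y ∈ e := h1 (by simp)
  have e1 : mx e = y := by
    refine mx_eq hy fun w hw => ?_
    by_cases hp : w ∈ ({x, y} : Finset ℕ)
    · simp at hp; omega
    · exact (h3 y (by simp) w hw hp).le
  have e2 : mx (e.erase y) = x := by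
    refine mx_eq (Finset.mem_erase.2 ⟨by omega, hx⟩) fun w hw => ?_
    obtain ⟨hwx, hw⟩ := Finset.mem_erase.1 hw
    by_cases hp : w ∈ ({x, y} : Finset ℕ)
    · simp at hp; omega
    · exact (h3 x (by simp) w hw hp).le
  rw [tl, e1, e2, walsh_symm]

theorem hd_insert (k : ℕ) (T : Finset ℕ) (a : ℕ) (hT : T.Nonempty) (ha : a < mn T) :
    hd k (insert a T) = walsh k a (mn T) := by
  obtain ⟨h1, h2⟩ := (sel_mn.ins T a hT).2 ha
  rw [hd, h2, Finset.erase_insert h1]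

theorem tl_insert (k : ℕ) (T : Finset ℕ) (a : ℕ) (hT : T.Nonempty) (ha : a > mx T) :
    tl k (insert a T) = walsh k a (mx T) := by
  obtain ⟨h1, h2⟩ := (sel_mx.ins T a hT).2 ha
  rw [tl, h2, Finset.erase_insert h1]

theorem mx_insert_low (T : Finset ℕ) (a : ℕ) (hT : T.Nonempty) (ha : a < mn T) :
    mx (insert a T) = mx T := by
  refine mx_eq (Finset.mem_insert_of_mem (mx_mem hT)) fun w hw => ?_
  rcases Finset.mem_insert.1 hw with rfl | hw
  · have := mn_le (mx_mem hT); omega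
  · exact le_mx hw

theorem tl_insert_low (k : ℕ) (T : Finset ℕ) (a : ℕ) (hT : 2 ≤ T.card) (ha : a < mn T) :
    tl k (insert a T) = tl k T := by
  have hne : T.Nonempty := Finset.card_pos.1 (by omega)
  have hm := mx_mem hne
  have h2 : a ≠ mx T := by have := mn_le hm; omega
  have hne' : (T.erase (mx T)).Nonempty :=
    Finset.card_pos.1 (by rw [Finset.card_erase_of_mem hm]; omega)
  have hlt : a < mn (T.erase (mx T)) :=
    lt_of_lt_of_le ha (mn_le (Finset.mem_of_mem_erase (mn_mem hne')))
  rw [tl, tl, mx_insert_low T a hne ha, Finset.erase_insert_of_ne h2,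
    mx_insert_low _ a hne' hlt]

theorem hd_abs (k : ℕ) (e : Finset ℕ) : |hd k e| = 1 := walsh_abs _ _ _

theorem tl_abs (k : ℕ) (e : Finset ℕ) : |tl k e| = 1 := walsh_abs _ _ _

/-- The extremal graph. -/
noncomputable def gr (r n k : ℕ) : RGraph r where
  verts := Finset.Icc 1 n
  edges := ((Finset.Icc 1 n).powersetCard r).filter (fun e => hd k e = 1 ∧ tl k e = -1)
  edges_subset := fun e he => (Finset.mem_powersetCard.1 (Finset.mem_filter.1 he).1).1
  edges_card := fun e he => (Finset.mem_powersetCard.1 (Finset.mem_filter.1 he).1).2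

theorem gr_no_pair (r n k : ℕ) : ¬ ∃ p e f : Finset ℕ, e ∈ (gr r n k).edges ∧
    f ∈ (gr r n k).edges ∧ IsHead id e p ∧ IsTail id f p := by
  rintro ⟨p, e, f, he, hf, hp, hq⟩
  have he := (Finset.mem_filter.1 he).2.1
  have hf := (Finset.mem_filter.1 hf).2.2
  obtain ⟨x, y, hxy, rfl⟩ := Finset.card_eq_two.1 hp.2.1
  rcases lt_or_gt_of_ne hxy with h | h
  · rw [hd_of_isHead k h hp] at he
    rw [tl_of_isTail k h hq] at hf
    linarith
  · rw [Finset.pair_comm] at hp hq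
    rw [hd_of_isHead k h hp] at he
    rw [tl_of_isTail k h hq] at hf
    linarith

theorem gr_count (r n k : ℕ) (hr : 3 ≤ r) (hn : n < 2 ^ k) (S : Finset ℕ)
    (hS : S ⊆ Finset.Icc 1 n) (η : ℝ) (hη : 0 ≤ η) (hk : 2 * ((k : ℝ) + 1) / 2 ^ k ≤ η ^ 2) :
    (S.card.choose r : ℝ) / 4 - η * (2 ^ k) ^ r ≤
      (((gr r n k).edges.filter (fun e => e ⊆ S)).card : ℝ) := by
  have hSr : S ⊆ Finset.range (2 ^ k) := fun x hx => by
    have := Finset.mem_Icc.1 (hS hx)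
    exact Finset.mem_range.2 (by omega)
  obtain ⟨j, rfl⟩ : ∃ j, r = j + 2 := ⟨r - 2, by omega⟩
  have hsq : (2 : ℝ) ^ k * (2 * ((k + 1) * 4 ^ k)) ≤ (η * (2 ^ k) ^ 2) ^ 2 := by
    rw [div_le_iff₀ (by positivity)] at hk
    have h4 : (4 : ℝ) ^ k = (2 ^ k) ^ 2 := by rw [← pow_mul, mul_comm, pow_mul]; norm_num
    rw [h4]
    have : 0 ≤ ((2 : ℝ) ^ k) ^ 3 := by positivity
    nlinarith [mul_le_mul_of_nonneg_right hk this]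
  have hb0 : 0 ≤ η * ((2 : ℝ) ^ k) ^ 2 := by positivity
  have hlt := abs_le_of_sq_le_sq' ((deg_bound_lt k S hSr).trans hsq) hb0 |>.2
  have hgt := abs_le_of_sq_le_sq' ((deg_bound_gt k S hSr).trans hsq) hb0 |>.2
  have hcard : (S.card : ℝ) ≤ 2 ^ k := by
    have := Finset.card_le_card hSr
    rw [Finset.card_range] at this
    exact_mod_cast this
  have hfin : ∀ X : ℝ, X ≤ η * ((2 : ℝ) ^ k) ^ 2 →
      X * (S.card : ℝ) ^ j ≤ η * (2 ^ k) ^ (j + 2) := by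
    intro X hX
    calc X * (S.card : ℝ) ^ j ≤ (η * ((2 : ℝ) ^ k) ^ 2) * (2 ^ k) ^ j := by gcongr
      _ = _ := by ring
  have b1 := (sum_sel_bound sel_mn S j (fun e => hd k e) (fun _ => 1) (walsh k) (by simp)
    (fun T a hT ha => by
      rw [hd_insert k T a (Finset.card_pos.1 (by omega)) ha, mul_one])).trans (hfin _ hlt)
  have b2 := (sum_sel_bound sel_mx S j (fun e => tl k e) (fun _ => 1) (walsh k) (by simp)
    (fun T a hT ha => by
      rw [tl_insert k T a (Finset.card_pos.1 (by omega)) ha, mul_one])).trans (hfin _ hgt)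
  have b3 := (sum_sel_bound sel_mn S j (fun e => hd k e * tl k e) (fun T => tl k T) (walsh k)
    (fun T => (tl_abs k T).le)
    (fun T a hT ha => by
      rw [hd_insert k T a (Finset.card_pos.1 (by omega)) ha,
        tl_insert_low k T a (by omega) ha])).trans (hfin _ hlt)
  have hset : (gr (j + 2) n k).edges.filter (fun e => e ⊆ S) =
      (S.powersetCard (j + 2)).filter (fun e => hd k e = 1 ∧ tl k e = -1) := by
    ext e
    simp only [gr, Finset.mem_filter, Finset.mem_powersetCard]
    constructor
    · rintro ⟨⟨⟨_, h2⟩, h3⟩, h4⟩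
      exact ⟨⟨h4, h2⟩, h3⟩
    · rintro ⟨⟨h4, h2⟩, h3⟩
      exact ⟨⟨⟨h4.trans hS, h2⟩, h3⟩, h4⟩
  have hcount : (((S.powersetCard (j + 2)).filter (fun e => hd k e = 1 ∧ tl k e = -1)).card : ℝ) =
      ((S.card.choose (j + 2) : ℝ) + (∑ e ∈ S.powersetCard (j + 2), hd k e)
        - (∑ e ∈ S.powersetCard (j + 2), tl k e)
        - ∑ e ∈ S.powersetCard (j + 2), hd k e * tl k e) / 4 := by
    rw [← Finset.card_powersetCard, Finset.card_eq_sum_ones (S.powersetCard (j + 2)),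
      Finset.card_eq_sum_ones, Finset.sum_filter]
    push_cast
    rw [← Finset.sum_add_distrib, ← Finset.sum_sub_distrib, ← Finset.sum_sub_distrib,
      Finset.sum_div]
    refine Finset.sum_congr rfl fun e _ => ?_
    rcases walsh_cases k (mn e) (mn (e.erase (mn e))) with h1 | h1 <;>
    rcases walsh_cases k (mx e) (mx (e.erase (mx e))) with h2 | h2 <;>
    · simp only [hd, tl, h1, h2]
      norm_num
  rw [hset, hcount]
  have c1 := abs_le.1 b1
  have c2 := abs_le.1 b2
  have c3 := abs_le.1 b3
  have : 0 ≤ η * ((2 : ℝ) ^ k) ^ (j + 2) := by positivity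
  linarith [c1.1, c2.2, c3.2]

theorem part_one (r : ℕ) (hr : 3 ≤ r) (δ : ℝ) (hδ : 0 < δ) : ∃ n₀ : ℕ, ∀ n ≥ n₀,
      ∃ H : RGraph r, H.verts = Finset.Icc 1 n ∧ IsDense H (1 / 4 : ℝ) δ ∧
        ¬ ∃ p e f : Finset ℕ, e ∈ H.edges ∧ f ∈ H.edges ∧
          IsHead id e p ∧ IsTail id f p := by
  set η : ℝ := δ * ((δ / 4) ^ r / r.factorial) with hηdef
  have hη : 0 < η := by positivity
  have ht : Filter.Tendsto (fun k : ℕ => 2 * ((k : ℝ) + 1) / 2 ^ k) Filter.atTop (nhds 0) := by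
    have h1 := tendsto_pow_const_div_const_pow_of_one_lt 1 (r := (2 : ℝ)) (by norm_num)
    have h0 := tendsto_pow_const_div_const_pow_of_one_lt 0 (r := (2 : ℝ)) (by norm_num)
    have := (h1.add h0).const_mul 2
    simp only [add_zero, mul_zero] at this
    refine this.congr fun k => ?_
    simp
    ring
  obtain ⟨K, hK⟩ := Filter.eventually_atTop.1
    (ht.eventually (ge_mem_nhds (show 0 < η ^ 2 by positivity)))
  obtain ⟨m, hm⟩ := exists_nat_ge (2 * r / δ)
  refine ⟨max (2 ^ K) m, fun n hn => ⟨gr r n n.size, rfl, ?_, gr_no_pair _ _ _⟩⟩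
  have hnK : 2 ^ K ≤ n := le_trans (le_max_left _ _) hn
  have hnm : m ≤ n := le_trans (le_max_right _ _) hn
  have hKs : K < n.size := Nat.lt_size.2 hnK
  have hN : 2 ^ n.size ≤ 2 * n := by
    have : 2 ^ (n.size - 1) ≤ n := Nat.lt_size.1 (by omega)
    calc 2 ^ n.size = 2 * 2 ^ (n.size - 1) := by rw [← pow_succ']; congr 1; omega
      _ ≤ _ := by omega
  intro S hS hcard
  have hS : S ⊆ Finset.Icc 1 n := hS
  have hcard : δ * n ≤ S.card := by simpa [gr] using hcard
  refine le_trans ?_ (gr_count r n n.size hr (Nat.lt_size_self n) S hS η hη.le (hK _ hKs.le))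
  have hs2r : 2 * (r : ℝ) ≤ S.card := by
    have : 2 * (r : ℝ) / δ ≤ n := hm.trans (by exact_mod_cast hnm)
    rw [div_le_iff₀ hδ] at this
    linarith
  have hs2r' : 2 * r ≤ S.card := by exact_mod_cast hs2r
  have hch := Nat.pow_le_choose (α := ℝ) r S.card
  have hhalf : (S.card : ℝ) / 2 ≤ ((S.card + 1 - r : ℕ) : ℝ) := by
    rw [Nat.cast_sub (by omega)]
    push_cast
    linarith
  have hN' : (2 : ℝ) ^ n.size ≤ 2 * n := by exact_mod_cast hN
  have hbase : δ / 4 * 2 ^ n.size ≤ ((S.card + 1 - r : ℕ) : ℝ) := by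
    refine le_trans ?_ hhalf
    nlinarith
  have hpow : (δ / 4 * 2 ^ n.size) ^ r ≤ ((S.card + 1 - r : ℕ) : ℝ) ^ r :=
    pow_le_pow_left₀ (by positivity) hbase r
  have key : (δ / 4) ^ r / r.factorial * (2 ^ n.size) ^ r ≤ (S.card.choose r : ℝ) := by
    refine le_trans ?_ hch
    rw [div_mul_eq_mul_div, ← mul_pow]
    gcongr
  have : η * (2 ^ n.size) ^ r ≤ δ * (S.card.choose r : ℝ) := by
    rw [hηdef, mul_assoc]
    exact mul_le_mul_of_nonneg_left key hδ.le
  linarith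

theorem part_two (r : ℕ) (hr : 3 ≤ r) : ∃ H : ℕ → RGraph r, LocallyDense H (1 / 4 : ℝ) ∧
      ∀ n, ¬ ∃ p e f : Finset ℕ, e ∈ (H n).edges ∧ f ∈ (H n).edges ∧
        IsHead id e p ∧ IsTail id f p := by
  have hpos : ∀ j : ℕ, 0 < 1 / ((j : ℝ) + 1) := fun j => by positivity
  have h : ∀ j : ℕ, ∃ H : RGraph r, j ≤ H.verts.card ∧ IsDense H (1 / 4 : ℝ) (1 / ((j : ℝ) + 1)) ∧
        ¬ ∃ p e f : Finset ℕ, e ∈ H.edges ∧ f ∈ H.edges ∧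
          IsHead id e p ∧ IsTail id f p := by
    intro j
    obtain ⟨n₀, h₀⟩ := part_one r hr _ (hpos j)
    obtain ⟨H, h1, h2, h3⟩ := h₀ (max n₀ j) (le_max_left _ _)
    exact ⟨H, by rw [h1]; simp, h2, h3⟩
  choose H h1 h2 h3 using h
  exact ⟨H, ⟨fun j => 1 / ((j : ℝ) + 1), hpos, tendsto_one_div_add_atTop_nhds_zero_nat,
    Filter.tendsto_atTop_mono h1 Filter.tendsto_id, h2⟩, h3⟩

/-- (1/4, δ)-dense r-graphs on `[n]` in which no pair of vertices is
both a head and a tail; in particular, a locally 1/4-dense sequence with this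
property. -/
theorem exists_dense_no_head_tail_pair :
    (∀ r : ℕ, 3 ≤ r → ∀ δ : ℝ, 0 < δ → ∃ n₀ : ℕ, ∀ n ≥ n₀,
      ∃ H : RGraph r, H.verts = Finset.Icc 1 n ∧ IsDense H (1 / 4 : ℝ) δ ∧
        ¬ ∃ p e f : Finset ℕ, e ∈ H.edges ∧ f ∈ H.edges ∧
          IsHead id e p ∧ IsTail id f p) ∧
    (∀ r : ℕ, 3 ≤ r → ∃ H : ℕ → RGraph r, LocallyDense H (1 / 4 : ℝ) ∧
      ∀ n, ¬ ∃ p e f : Finset ℕ, e ∈ (H n).edges ∧ f ∈ (H n).edges ∧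
        IsHead id e p ∧ IsTail id f p) := by
  exact ⟨part_one, part_two⟩

end UTD
end

section
/- For every integer r ≥ 3 and every δ > 0 there exists n_0 such that for every n ≥ n_0 there exist an r-graph H on the vertex set [n] = {1,…,n} and a function φ assigning to each pair of vertices a 2-element subset of [r], such that H is (C(r,2)^(−C(r,2)),δ)-dense and for every edge e of H and every pair of vertices {u,v} ⊆ e, the pair {u,v} plays the role φ({u,v}) in e with respect to the natural order on [n]. -/
namespace UTD

lemma sum_update_aux {ι β : Type*} [Fintype ι] [DecidableEq ι] [Fintype β] (i : ι)
    (f : (ι → β) → ℝ) :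
    ∑ x, ∑ u, f (Function.update x i u) = Fintype.card β * ∑ x, f x := by
  classical
  have h1 : ∑ x, ∑ u, f (Function.update x i u)
      = ∑ q : (ι → β) × β, f (Function.update q.1 i q.2) := by
    rw [Fintype.sum_prod_type]
  have h2 : ∑ q : (ι → β) × β, f (Function.update q.1 i q.2)
      = ∑ q : (ι → β) × β, f q.1 := by
    let F : (ι → β) × β → (ι → β) × β := fun q => (Function.update q.1 i q.2, q.1 i)
    have hF : Function.Involutive F := by
      intro q
      ext <;> simp [F]
    exact Fintype.sum_equiv hF.toPerm _ _ (fun q => rfl)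
  rw [h1, h2, Fintype.sum_prod_type]
  simp [Finset.mul_sum]

lemma cut_bound {V : Type*} [Fintype V] (g : V → V → ℝ) (a b : V → ℝ)
    (ha : ∀ u, |a u| ≤ 1) (hb : ∀ u, |b u| ≤ 1) :
    (∑ u, ∑ v, a u * b v * g u v) ^ 4
      ≤ (Fintype.card V : ℝ) ^ 4 * ∑ v, ∑ v', (∑ u, g u v * g u v') ^ 2 := by
  have ha2 : ∀ u, a u ^ 2 ≤ 1 := fun u => (sq_le_one_iff_abs_le_one _).2 (ha u)
  have hb2 : ∀ u, b u ^ 2 ≤ 1 := fun u => (sq_le_one_iff_abs_le_one _).2 (hb u)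
  have hsa : ∑ u, a u ^ 2 ≤ Fintype.card V := by
    calc ∑ u, a u ^ 2 ≤ ∑ u : V, (1 : ℝ) := Finset.sum_le_sum (fun u _ => ha2 u)
      _ = _ := by simp
  have hsb : ∑ q : V × V, (b q.1 * b q.2) ^ 2 ≤ (Fintype.card V : ℝ) ^ 2 := by
    calc ∑ q : V × V, (b q.1 * b q.2) ^ 2 ≤ ∑ q : V × V, (1 : ℝ) := by
          refine Finset.sum_le_sum (fun q _ => ?_)
          rw [mul_pow]
          exact mul_le_one₀ (hb2 _) (sq_nonneg _) (hb2 _)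
      _ = _ := by simp [sq]
  set n : ℝ := ((Fintype.card V : ℕ) : ℝ)
  have hn : 0 ≤ n := by positivity
  have e1 : ∑ u, ∑ v, a u * b v * g u v = ∑ u, a u * ∑ v, b v * g u v := by
    simp [Finset.mul_sum, mul_assoc]
  have c1 : (∑ u, ∑ v, a u * b v * g u v) ^ 2 ≤ n * ∑ u, (∑ v, b v * g u v) ^ 2 := by
    rw [e1]
    refine (Finset.sum_mul_sq_le_sq_mul_sq _ _ _).trans ?_
    exact mul_le_mul_of_nonneg_right hsa (Finset.sum_nonneg fun _ _ => sq_nonneg _)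
  have e2 : ∑ u, (∑ v, b v * g u v) ^ 2
      = ∑ q : V × V, (b q.1 * b q.2) * ∑ u, g u q.1 * g u q.2 := by
    rw [Fintype.sum_prod_type]
    simp_rw [sq, Finset.sum_mul_sum, Finset.mul_sum]
    rw [Finset.sum_comm]
    refine Finset.sum_congr rfl fun v _ => ?_
    rw [Finset.sum_comm]
    refine Finset.sum_congr rfl fun v' _ => Finset.sum_congr rfl fun u _ => by ring
  have c2 : (∑ u, (∑ v, b v * g u v) ^ 2) ^ 2
      ≤ n ^ 2 * ∑ v, ∑ v', (∑ u, g u v * g u v') ^ 2 := by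
    rw [e2]
    refine (Finset.sum_mul_sq_le_sq_mul_sq _ _ _).trans ?_
    rw [← Fintype.sum_prod_type (fun q : V × V => (∑ u, g u q.1 * g u q.2) ^ 2)]
    exact mul_le_mul_of_nonneg_right hsb (Finset.sum_nonneg fun _ _ => sq_nonneg _)
  calc (∑ u, ∑ v, a u * b v * g u v) ^ 4 = ((∑ u, ∑ v, a u * b v * g u v) ^ 2) ^ 2 := by ring
    _ ≤ (n * ∑ u, (∑ v, b v * g u v) ^ 2) ^ 2 := pow_le_pow_left₀ (sq_nonneg _) c1 2
    _ = n ^ 2 * (∑ u, (∑ v, b v * g u v) ^ 2) ^ 2 := by ring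
    _ ≤ n ^ 2 * (n ^ 2 * ∑ v, ∑ v', (∑ u, g u v * g u v') ^ 2) :=
        mul_le_mul_of_nonneg_left c2 (by positivity)
    _ = _ := by ring

lemma exists_quasirandom {V κ : Type*} [Fintype V] [DecidableEq V] [Fintype κ] [DecidableEq κ]
    [Nonempty κ] (w : V → V → ℝ) (hw : ∀ u v, |w u v| ≤ 1)
    (h : κ → κ → ℝ) (hh : ∀ c k, |h c k| ≤ 1) (h0 : ∀ c, ∑ k, h c k = 0) :
    ∃ ψ : V × V → κ, ∀ c,
      ∑ v, ∑ v', (∑ u, (w u v * h c (ψ (u, v))) * (w u v' * h c (ψ (u, v')))) ^ 2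
        ≤ 2 * Fintype.card κ * (Fintype.card V : ℝ) ^ 3 := by
  set T : κ → (V × V → κ) → ℝ := fun c ψ =>
    ∑ v, ∑ v', (∑ u, (w u v * h c (ψ (u, v))) * (w u v' * h c (ψ (u, v')))) ^ 2 with hT
  have hTnn : ∀ c ψ, 0 ≤ T c ψ := fun c ψ =>
    Finset.sum_nonneg fun _ _ => Finset.sum_nonneg fun _ _ => sq_nonneg _
  set N : ℝ := ((Fintype.card (V × V → κ) : ℕ) : ℝ) with hN
  have hN0 : 0 ≤ N := by positivity
  have key : ∀ c (v v' u u' : V),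
      ∑ ψ : V × V → κ, ((w u v * h c (ψ (u, v))) * (w u v' * h c (ψ (u, v')))) *
        ((w u' v * h c (ψ (u', v))) * (w u' v' * h c (ψ (u', v'))))
      ≤ N * ((if v = v' then 1 else 0) + (if u = u' then 1 else 0)) := by
    intro c v v' u u'
    by_cases hd : v = v' ∨ u = u'
    · have hb : ∀ u v (ψ : V × V → κ), |w u v * h c (ψ (u, v))| ≤ 1 := by
        intro u v ψ
        rw [abs_mul]
        exact mul_le_one₀ (hw _ _) (abs_nonneg _) (hh _ _)
      have h1 : ∑ ψ : V × V → κ, ((w u v * h c (ψ (u, v))) * (w u v' * h c (ψ (u, v')))) *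
        ((w u' v * h c (ψ (u', v))) * (w u' v' * h c (ψ (u', v')))) ≤ ∑ ψ : V × V → κ, (1 : ℝ) := by
        refine Finset.sum_le_sum fun ψ _ => (le_abs_self _).trans ?_
        rw [abs_mul, abs_mul, abs_mul (w u' v * _)]
        exact mul_le_one₀ (mul_le_one₀ (hb _ _ _) (abs_nonneg _) (hb _ _ _))
          (by positivity) (mul_le_one₀ (hb _ _ _) (abs_nonneg _) (hb _ _ _))
      refine h1.trans ?_
      have h2 : ∑ ψ : V × V → κ, (1 : ℝ) = N := by simp [hN]
      rw [h2]
      refine le_mul_of_one_le_right hN0 ?_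
      rcases hd with hd | hd <;> simp only [hd, if_true] <;> split_ifs <;> norm_num
    · push Not at hd
      have hz := sum_update_aux (u, v) (fun ψ : V × V → κ =>
        ((w u v * h c (ψ (u, v))) * (w u v' * h c (ψ (u, v')))) *
        ((w u' v * h c (ψ (u', v))) * (w u' v' * h c (ψ (u', v')))))
      have hl : ∑ ψ : V × V → κ, ∑ k, (fun ψ : V × V → κ =>
        ((w u v * h c (ψ (u, v))) * (w u v' * h c (ψ (u, v')))) *
        ((w u' v * h c (ψ (u', v))) * (w u' v' * h c (ψ (u', v')))))
          (Function.update ψ (u, v) k) = 0 := by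
        refine Finset.sum_eq_zero fun ψ _ => ?_
        have n1 : ((u, v') : V × V) ≠ (u, v) := by
          intro h; exact hd.1 (Prod.ext_iff.1 h).2.symm
        have n2 : ((u', v) : V × V) ≠ (u, v) := by
          intro h; exact hd.2 (Prod.ext_iff.1 h).1.symm
        have n3 : ((u', v') : V × V) ≠ (u, v) := by
          intro h; exact hd.2 (Prod.ext_iff.1 h).1.symm
        simp only [Function.update_self, Function.update_of_ne n1, Function.update_of_ne n2,
          Function.update_of_ne n3]
        have : ∀ k, ((w u v * h c k) * (w u v' * h c (ψ (u, v')))) *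
          ((w u' v * h c (ψ (u', v))) * (w u' v' * h c (ψ (u', v'))))
          = h c k * (w u v * (w u v' * h c (ψ (u, v'))) *
          ((w u' v * h c (ψ (u', v))) * (w u' v' * h c (ψ (u', v'))))) := fun k => by ring
        simp_rw [this, ← Finset.sum_mul, h0, zero_mul]
      rw [hl] at hz
      have hk : (Fintype.card κ : ℝ) ≠ 0 := by simp
      rcases mul_eq_zero.1 hz.symm with h | h
      · exact absurd h hk
      · rw [h]
        simp [hd]
  have hc : ∀ c, ∑ ψ, T c ψ ≤ N * (2 * (Fintype.card V : ℝ) ^ 3) := by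
    intro c
    have : ∑ ψ, T c ψ = ∑ v, ∑ v', ∑ u, ∑ u', ∑ ψ : V × V → κ,
        ((w u v * h c (ψ (u, v))) * (w u v' * h c (ψ (u, v')))) *
        ((w u' v * h c (ψ (u', v))) * (w u' v' * h c (ψ (u', v')))) := by
      simp only [hT, sq, Finset.sum_mul_sum]
      rw [Finset.sum_comm]
      refine Finset.sum_congr rfl fun v _ => ?_
      rw [Finset.sum_comm]
      refine Finset.sum_congr rfl fun v' _ => ?_
      rw [Finset.sum_comm]
      refine Finset.sum_congr rfl fun u _ => ?_
      rw [Finset.sum_comm]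
    rw [this]
    calc _ ≤ ∑ v : V, ∑ v' : V, ∑ u : V, ∑ u' : V,
          N * ((if v = v' then 1 else 0) + (if u = u' then 1 else 0)) := by
          refine Finset.sum_le_sum fun v _ => Finset.sum_le_sum fun v' _ =>
            Finset.sum_le_sum fun u _ => Finset.sum_le_sum fun u' _ => key c v v' u u'
      _ = _ := by
          simp only [← Finset.mul_sum, Finset.sum_add_distrib]
          simp
          left; ring
  obtain ⟨ψ, -, hψ⟩ := Finset.exists_le_of_sum_le (s := (Finset.univ : Finset (V × V → κ)))
    (f := fun ψ => ∑ c, T c ψ) (g := fun _ => 2 * Fintype.card κ * (Fintype.card V : ℝ) ^ 3)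
    Finset.univ_nonempty (by
      rw [Finset.sum_comm]
      calc _ ≤ ∑ c : κ, N * (2 * (Fintype.card V : ℝ) ^ 3) := Finset.sum_le_sum fun c _ => hc c
        _ = _ := by
          simp only [Finset.sum_const, Finset.card_univ, nsmul_eq_mul]
          rw [← hN]; ring
        _ ≤ _ := le_rfl)
  refine ⟨ψ, fun c => le_trans ?_ hψ⟩
  exact Finset.single_le_sum (f := fun c => T c ψ) (fun c _ => hTnn c ψ) (Finset.mem_univ c)

lemma step_aux {ι V : Type*} [Fintype ι] [DecidableEq ι] [Fintype V] (η : ℝ) (i j : ι)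
    (hij : i ≠ j) (g : V → V → ℝ)
    (hg : ∀ a b : V → ℝ, (∀ u, |a u| ≤ 1) → (∀ v, |b v| ≤ 1) →
      |∑ u, ∑ v, a u * b v * g u v| ≤ η)
    (R : (ι → V) → ℝ)
    (hR : ∀ x, ∃ a b : V → ℝ, (∀ u, |a u| ≤ 1) ∧ (∀ v, |b v| ≤ 1) ∧
      ∀ u v, R (Function.update (Function.update x i u) j v) = a u * b v) :
    (Fintype.card V : ℝ) ^ 2 * |∑ x, R x * g (x i) (x j)|
      ≤ (Fintype.card V : ℝ) ^ (Fintype.card ι) * η := by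
  have e : (Fintype.card V : ℝ) ^ 2 * ∑ x, R x * g (x i) (x j)
      = ∑ x : ι → V, ∑ u, ∑ v, R (Function.update (Function.update x i u) j v) * g u v := by
    rw [sq, mul_assoc, ← sum_update_aux j (fun x => R x * g (x i) (x j)), ← sum_update_aux i]
    simp [Function.update_of_ne hij]
  have e' : (Fintype.card V : ℝ) ^ 2 * |∑ x, R x * g (x i) (x j)|
      = |(Fintype.card V : ℝ) ^ 2 * ∑ x, R x * g (x i) (x j)| := by
    rw [abs_mul, abs_of_nonneg (a := (Fintype.card V : ℝ) ^ 2) (by positivity)]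
  rw [e', e]
  refine (Finset.abs_sum_le_sum_abs _ _).trans ?_
  calc _ ≤ ∑ x : ι → V, η := by
        refine Finset.sum_le_sum fun x _ => ?_
        obtain ⟨a, b, ha, hb, hab⟩ := hR x
        simp_rw [hab]
        exact hg a b ha hb
    _ = _ := by simp

lemma telescoping {r : ℕ} {V : Type*} [Fintype V] (η : ℝ)
    (P : Finset (Fin r × Fin r)) (hP : ∀ p ∈ P, p.1 < p.2)
    (A B : Fin r × Fin r → V → V → ℝ) (hA : ∀ p u v, |A p u v| ≤ 1)
    (hB : ∀ p u v, |B p u v| ≤ 1) (s : V → ℝ) (hs : ∀ u, |s u| ≤ 1)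
    (hg : ∀ p, ∀ a b : V → ℝ, (∀ u, |a u| ≤ 1) → (∀ v, |b v| ≤ 1) →
      |∑ u, ∑ v, a u * b v * (A p u v - B p u v)| ≤ η)
    (Q : Finset (Fin r × Fin r)) (hQ : Q ⊆ P) :
    (Fintype.card V : ℝ) ^ 2 * |∑ x : Fin r → V, (∏ i, s (x i)) * ∏ p ∈ P, A p (x p.1) (x p.2)
      - ∑ x : Fin r → V, (∏ i, s (x i)) *
          ∏ p ∈ P, (if p ∈ Q then B p else A p) (x p.1) (x p.2)|
      ≤ Q.card * ((Fintype.card V : ℝ) ^ r * η) := by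
  induction Q using Finset.induction_on with
  | empty => simp
  | insert p₀ Q hp₀ ih =>
    have ih := ih (fun p hp => hQ (Finset.mem_insert_of_mem hp))
    have hpP : p₀ ∈ P := hQ (Finset.mem_insert_self _ _)
    set D : Fin r × Fin r → V → V → ℝ := fun p => if p ∈ Q then B p else A p with hD
    have hD1 : ∀ p u v, |D p u v| ≤ 1 := by
      intro p u v
      simp only [hD]
      split_ifs
      · exact hB _ _ _
      · exact hA _ _ _
    have hst := step_aux η p₀.1 p₀.2 (hP _ hpP).ne (fun u v => A p₀ u v - B p₀ u v) (hg p₀)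
      (fun x => (∏ i, s (x i)) * ∏ p ∈ P.erase p₀, D p (x p.1) (x p.2)) (by
        intro x
        let Good : (V → V → ℝ) → Prop := fun f => ∃ a b : V → ℝ, (∀ u, |a u| ≤ 1) ∧
          (∀ v, |b v| ≤ 1) ∧ ∀ u v, f u v = a u * b v
        have Gmul : ∀ f g, Good f → Good g → Good (fun u v => f u v * g u v) := by
          rintro f g ⟨a, b, ha, hb, hab⟩ ⟨a', b', ha', hb', hab'⟩
          refine ⟨fun u => a u * a' u, fun v => b v * b' v, fun u => ?_, fun u => ?_, fun u v => ?_⟩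
          · rw [abs_mul]; exact mul_le_one₀ (ha u) (abs_nonneg _) (ha' u)
          · rw [abs_mul]; exact mul_le_one₀ (hb u) (abs_nonneg _) (hb' u)
          · simp only [hab, hab']; ring
        have Gprod : ∀ {α : Type} (t : Finset α) (f : α → V → V → ℝ), (∀ a ∈ t, Good (f a)) →
            Good (fun u v => ∏ a ∈ t, f a u v) := by
          classical
          intro α t f hf
          induction t using Finset.induction_on with
          | empty => exact ⟨fun _ => 1, fun _ => 1, by simp, by simp, by simp⟩
          | insert a t ha ih =>
            simp only [Finset.prod_insert ha]
            exact Gmul _ _ (hf _ (Finset.mem_insert_self _ _))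
              (ih fun b hb => hf _ (Finset.mem_insert_of_mem hb))
        have hne : p₀.1 ≠ p₀.2 := (hP _ hpP).ne
        have hu : ∀ u v i, Function.update (Function.update x p₀.1 u) p₀.2 v i
            = if i = p₀.2 then v else if i = p₀.1 then u else x i := by
          intro u v i
          simp only [Function.update_apply]
        refine Gmul (fun u v => ∏ i, s (Function.update (Function.update x p₀.1 u) p₀.2 v i))
          (fun u v => ∏ p ∈ P.erase p₀, D p
            (Function.update (Function.update x p₀.1 u) p₀.2 v p.1)
            (Function.update (Function.update x p₀.1 u) p₀.2 v p.2))
          (Gprod _ (fun i u v => s (Function.update (Function.update x p₀.1 u) p₀.2 v i)) ?_)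
          (Gprod _ (fun p u v => D p
            (Function.update (Function.update x p₀.1 u) p₀.2 v p.1)
            (Function.update (Function.update x p₀.1 u) p₀.2 v p.2)) ?_)
        · intro i _
          simp only [hu]
          by_cases h2 : i = p₀.2
          · exact ⟨fun _ => 1, s, by simp, hs, by simp [h2]⟩
          · by_cases h1 : i = p₀.1
            · exact ⟨s, fun _ => 1, hs, by simp, by simp [h1, hne]⟩
            · exact ⟨fun _ => s (x i), fun _ => 1, fun _ => hs _, by simp, by simp [h1, h2]⟩
        · intro p hp
          have hpp := Finset.mem_erase.1 hp
          have hlt := hP _ hpp.2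
          have hlt0 := hP _ hpP
          simp only [hu]
          by_cases h : p.1 = p₀.2 ∨ p.2 = p₀.2
          · have : p.1 ≠ p₀.1 ∧ p.2 ≠ p₀.1 := by
              constructor
              · intro h1
                rcases h with h | h
                · exact hne (h1.symm.trans h)
                · exact hpp.1 (Prod.ext h1 h)
              · intro h1
                rcases h with h | h
                · rw [h, h1] at hlt; exact absurd hlt hlt0.asymm
                · exact hne (h1.symm.trans h)
            refine ⟨fun _ => 1, fun v => D p (if p.1 = p₀.2 then v else x p.1)
              (if p.2 = p₀.2 then v else x p.2), by simp, fun v => hD1 _ _ _, fun u v => ?_⟩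
            simp [this]
          · push Not at h
            refine ⟨fun u => D p (if p.1 = p₀.1 then u else x p.1)
              (if p.2 = p₀.1 then u else x p.2), fun _ => 1, fun v => hD1 _ _ _, by simp,
              fun u v => ?_⟩
            simp [h])
    have e : (∑ x : Fin r → V, (∏ i, s (x i)) * ∏ p ∈ P, D p (x p.1) (x p.2))
        - ∑ x : Fin r → V, (∏ i, s (x i)) *
          ∏ p ∈ P, (if p ∈ insert p₀ Q then B p else A p) (x p.1) (x p.2)
        = ∑ x : Fin r → V, ((∏ i, s (x i)) * ∏ p ∈ P.erase p₀, D p (x p.1) (x p.2)) *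
          (A p₀ (x p₀.1) (x p₀.2) - B p₀ (x p₀.1) (x p₀.2)) := by
      rw [← Finset.sum_sub_distrib]
      refine Finset.sum_congr rfl fun x _ => ?_
      rw [← Finset.mul_prod_erase P _ hpP, ← Finset.mul_prod_erase P _ hpP]
      have e1 : ∏ p ∈ P.erase p₀, (if p ∈ insert p₀ Q then B p else A p) (x p.1) (x p.2)
          = ∏ p ∈ P.erase p₀, D p (x p.1) (x p.2) := by
        refine Finset.prod_congr rfl fun p hp => ?_
        simp [hD, (Finset.mem_erase.1 hp).1]
      rw [e1]
      simp only [hD, hp₀, Finset.mem_insert_self, if_true, if_false]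
      ring
    rw [Finset.card_insert_of_notMem hp₀]
    push_cast
    rw [Fintype.card_fin] at hst
    rw [← e] at hst
    have tri := abs_sub_le
      (∑ x : Fin r → V, (∏ i, s (x i)) * ∏ p ∈ P, A p (x p.1) (x p.2))
      (∑ x : Fin r → V, (∏ i, s (x i)) * ∏ p ∈ P, D p (x p.1) (x p.2))
      (∑ x : Fin r → V, (∏ i, s (x i)) *
          ∏ p ∈ P, (if p ∈ insert p₀ Q then B p else A p) (x p.1) (x p.2))
    have := mul_le_mul_of_nonneg_left tri (by positivity : (0:ℝ) ≤ (Fintype.card V : ℝ) ^ 2)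
    linarith

lemma card_lt_fin {r : ℕ} (j : Fin r) :
    ((Finset.univ : Finset (Fin r)).filter (fun i => i < j)).card = (j : ℕ) := by
  have : (Finset.univ : Finset (Fin r)).filter (fun i => i < j) = Finset.Iio j := by
    ext i; simp
  rw [this, Fin.card_Iio]

/-- The possible roles of a pair. -/
abbrev Roles (r : ℕ) : Type := {c // c ∈ Finset.powersetCard 2 (Finset.Icc 1 r)}

lemma card_pairs (r : ℕ) :
    ((Finset.univ : Finset (Fin r × Fin r)).filter (fun p => p.1 < p.2)).card = r.choose 2 := by
  rw [Finset.card_filter, Fintype.sum_prod_type_right]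
  have : ∀ j : Fin r, (∑ i : Fin r, if i < j then 1 else 0) = (j : ℕ) := by
    intro j; rw [← Finset.card_filter]; exact card_lt_fin j
  simp only [this]
  rw [Fin.sum_univ_eq_sum_range (fun i => i) r, Finset.sum_range_id, Nat.choose_two_right]

lemma role_image {r : ℕ} (x : Fin r → ℕ) (hx : StrictMono x) (i j : Fin r) :
    role id (Finset.univ.image x) {x i, x j} = {(i : ℕ) + 1, (j : ℕ) + 1} := by
  have h : ∀ i : Fin r, ((Finset.univ.image x).filter (fun w => w < x i)).card = (i : ℕ) := by
    intro i
    rw [Finset.filter_image, Finset.card_image_of_injective _ hx.injective]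
    simp only [hx.lt_iff_lt]
    exact card_lt_fin i
  simp [role, Finset.image_insert, h]

lemma core (r : ℕ) (hr : 3 ≤ r) (n : ℕ) :
    ∃ H : RGraph r, ∃ φ : ℕ → ℕ → Finset ℕ,
      H.verts = Finset.Icc 1 n ∧
      (∀ S ⊆ H.verts, ∀ η : ℝ, 0 ≤ η → 2 * (r.choose 2 : ℝ) * (n : ℝ) ^ 7 ≤ η ^ 4 →
        (n : ℝ) ^ 2 * (piR r * (S.card.choose r : ℝ) -
          ((H.edges.filter (fun e => e ⊆ S)).card : ℝ)) ≤ (r.choose 2 : ℝ) * ((n : ℝ) ^ r * η)) ∧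
      (∀ u ∈ H.verts, ∀ v ∈ H.verts, u ≠ v →
        φ u v = φ v u ∧ φ u v ⊆ Finset.Icc 1 r ∧ (φ u v).card = 2) ∧
      (∀ e ∈ H.edges, ∀ u ∈ e, ∀ v ∈ e, u ≠ v → role id e {u, v} = φ u v) := by
  classical
  have hκ : Fintype.card (Roles r) = r.choose 2 := by
    rw [Fintype.card_coe]; simp
  have hKpos : 0 < r.choose 2 := Nat.choose_pos (by omega)
  have : Nonempty (Roles r) := Fintype.card_pos_iff.1 (hκ ▸ hKpos)
  set K : ℝ := ((r.choose 2 : ℕ) : ℝ) with hK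
  have hK1 : 1 ≤ K := by rw [hK]; exact_mod_cast hKpos
  have hKi0 : 0 ≤ 1 / K := by positivity
  have hKi1 : 1 / K ≤ 1 := by rw [div_le_one (by linarith)]; exact hK1
  let w : Fin n → Fin n → ℝ := fun u v => if u < v then 1 else 0
  have hw : ∀ u v, |w u v| ≤ 1 := by
    intro u v; simp only [w]; split_ifs <;> simp
  let h : Roles r → Roles r → ℝ := fun c k => (if k = c then 1 else 0) - 1 / K
  obtain ⟨ψ, hψ⟩ := exists_quasirandom w hw h
    (by
      intro c k; simp only [h]
      rw [abs_le]
      split_ifs <;> constructor <;> linarith)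
    (by
      intro c
      simp only [h, Finset.sum_sub_distrib]
      simp only [Finset.sum_ite_eq', Finset.mem_univ, if_true, Finset.sum_const, Finset.card_univ,
        hκ, nsmul_eq_mul, ← hK]
      field_simp
      ring)
  let ψ' : ℕ → ℕ → Roles r := fun a b =>
    if hab : a - 1 < n ∧ b - 1 < n then ψ (⟨a - 1, hab.1⟩, ⟨b - 1, hab.2⟩)
    else Classical.arbitrary (Roles r)
  have hψ' : ∀ u v : Fin n, ψ' (u + 1) (v + 1) = ψ (u, v) := by
    intro u v; simp [ψ']
  let φ : ℕ → ℕ → Finset ℕ := fun u v => (ψ' (min u v) (max u v)).1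
  let H : RGraph r :=
    { verts := Finset.Icc 1 n
      edges := (Finset.powersetCard r (Finset.Icc 1 n)).filter
        (fun e => ∀ u ∈ e, ∀ v ∈ e, u ≠ v → role id e {u, v} = φ u v)
      edges_subset := by
        intro e he
        exact (Finset.mem_powersetCard.1 (Finset.mem_filter.1 he).1).1
      edges_card := by
        intro e he
        exact (Finset.mem_powersetCard.1 (Finset.mem_filter.1 he).1).2 }
  refine ⟨H, φ, rfl, ?_, ?_, ?_⟩
  · intro S hS η hη hη4
    have hSn : S ⊆ Finset.Icc 1 n := hS
    let c : Fin r × Fin r → Roles r := fun p =>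
      if hp : p.1 < p.2 then ⟨{(p.1 : ℕ) + 1, (p.2 : ℕ) + 1}, by
        rw [Finset.mem_powersetCard]
        refine ⟨?_, Finset.card_pair (by have : (p.1 : ℕ) < p.2 := hp; omega)⟩
        intro y hy
        simp only [Finset.mem_insert, Finset.mem_singleton] at hy
        rw [Finset.mem_Icc]
        have h1 := p.1.2
        have h2 := p.2.2
        omega⟩
      else Classical.arbitrary (Roles r)
    have hc : ∀ p : Fin r × Fin r, p.1 < p.2 → (c p).1 = {(p.1 : ℕ) + 1, (p.2 : ℕ) + 1} := by
      intro p hp; simp only [c, dif_pos hp]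
    let s : Fin n → ℝ := fun u => if (u : ℕ) + 1 ∈ S then 1 else 0
    let P := (Finset.univ : Finset (Fin r × Fin r)).filter (fun p => p.1 < p.2)
    have hPmem : ∀ p, p ∈ P ↔ p.1 < p.2 := by intro p; simp [P]
    have hPc : P.card = r.choose 2 := card_pairs r
    let A : Fin r × Fin r → Fin n → Fin n → ℝ := fun p u v =>
      w u v * (if ψ (u, v) = c p then 1 else 0)
    let B : Fin r × Fin r → Fin n → Fin n → ℝ := fun p u v => w u v * (1 / K)
    have hg : ∀ p, ∀ a b : Fin n → ℝ, (∀ u, |a u| ≤ 1) → (∀ v, |b v| ≤ 1) →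
      |∑ u, ∑ v, a u * b v * (A p u v - B p u v)| ≤ η := by
      intro p a b ha hb
      have hcut := cut_bound (fun u v => w u v * h (c p) (ψ (u, v))) a b ha hb
      have hq := hψ (c p)
      rw [hκ, ← hK, Fintype.card_fin] at hq
      rw [Fintype.card_fin] at hcut
      have hAB : ∀ u v, A p u v - B p u v = w u v * h (c p) (ψ (u, v)) := by
        intro u v; simp only [A, B, h]; ring
      simp only [hAB]
      have h4 : (∑ u, ∑ v, a u * b v * (w u v * h (c p) (ψ (u, v)))) ^ 4 ≤ η ^ 4 := by
        refine hcut.trans (le_trans ?_ hη4)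
        calc _ ≤ (n : ℝ) ^ 4 * (2 * K * (n : ℝ) ^ 3) :=
              mul_le_mul_of_nonneg_left hq (by positivity)
          _ = _ := by ring
      refine le_of_pow_le_pow_left₀ (n := 4) (by norm_num) hη ?_
      rwa [Even.pow_abs (by decide)]
    have htel := telescoping η P (fun p hp => (hPmem p).1 hp) A B
      (by
        intro p u v; simp only [A]; rw [abs_mul]
        refine mul_le_one₀ (hw _ _) (abs_nonneg _) ?_
        split_ifs <;> simp)
      (by
        intro p u v; simp only [B]; rw [abs_mul]
        refine mul_le_one₀ (hw _ _) (abs_nonneg _) ?_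
        rwa [abs_of_nonneg hKi0])
      s (by intro u; simp only [s]; split_ifs <;> simp) hg P (Finset.Subset.refl _)
    rw [hPc, ← hK, Fintype.card_fin] at htel
    have hBeq : ∀ x : Fin r → Fin n,
        ∏ p ∈ P, (if p ∈ P then B p else A p) (x p.1) (x p.2) = ∏ p ∈ P, B p (x p.1) (x p.2) :=
      fun x => Finset.prod_congr rfl fun p hp => by rw [if_pos hp]
    simp only [hBeq] at htel
    let emb : (Fin r → Fin n) → Finset ℕ := fun x => Finset.univ.image (fun i => (x i : ℕ) + 1)
    have hmono : ∀ x : Fin r → Fin n, StrictMono x → StrictMono (fun i => (x i : ℕ) + 1) := by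
      intro x hx i j hij
      have : (x i : ℕ) < x j := hx hij
      simpa using this
    let XA : Finset (Fin r → Fin n) := Finset.univ.filter (fun x => StrictMono x ∧
      (∀ i, (x i : ℕ) + 1 ∈ S) ∧ ∀ p ∈ P, ψ (x p.1, x p.2) = c p)
    let XB : Finset (Fin r → Fin n) := Finset.univ.filter (fun x => StrictMono x ∧
      (∀ i, (x i : ℕ) + 1 ∈ S))
    -- upper bound for the A-count
    have hNA : ∑ x : Fin r → Fin n, (∏ i, s (x i)) * ∏ p ∈ P, A p (x p.1) (x p.2)
        ≤ ((H.edges.filter (fun e => e ⊆ S)).card : ℝ) := by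
      have h1 : ∑ x : Fin r → Fin n, (∏ i, s (x i)) * ∏ p ∈ P, A p (x p.1) (x p.2)
          ≤ (XA.card : ℝ) := by
        rw [Finset.card_filter]
        push_cast
        refine Finset.sum_le_sum fun x _ => ?_
        split_ifs with hx
        · obtain ⟨hx1, hx2, hx3⟩ := hx
          have e1 : ∏ i, s (x i) = 1 := Finset.prod_eq_one fun i _ => by simp [s, hx2 i]
          have e2 : ∏ p ∈ P, A p (x p.1) (x p.2) = 1 := Finset.prod_eq_one fun p hp => by
            simp [A, w, hx3 p hp, hx1 ((hPmem p).1 hp)]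
          rw [e1, e2]; norm_num
        · refine le_of_eq ?_
          by_contra hne
          apply hx
          have hne1 := left_ne_zero_of_mul hne
          have hne2 := right_ne_zero_of_mul hne
          rw [Finset.prod_ne_zero_iff] at hne1 hne2
          refine ⟨?_, ?_, ?_⟩
          · intro i j hij
            have := left_ne_zero_of_mul (hne2 (i, j) ((hPmem _).2 hij))
            by_contra hlt
            exact this (if_neg hlt)
          · intro i
            by_contra hi
            exact hne1 i (Finset.mem_univ _) (if_neg hi)
          · intro p hp
            have := right_ne_zero_of_mul (hne2 p hp)
            by_contra hlt
            exact this (if_neg hlt)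
      refine h1.trans ?_
      norm_cast
      refine Finset.card_le_card_of_injOn emb ?_ ?_
      · intro x hx
        obtain ⟨hx1, hx2, hx3⟩ := (Finset.mem_filter.1 hx).2
        have hxm := hmono x hx1
        have hsub : emb x ⊆ S := by
          intro y hy
          obtain ⟨i, -, rfl⟩ := Finset.mem_image.1 hy
          exact hx2 i
        have hlt : ∀ i j : Fin r, i < j → role id (emb x) {(x i : ℕ) + 1, (x j : ℕ) + 1}
            = φ ((x i : ℕ) + 1) ((x j : ℕ) + 1) := by
          intro i j hij
          have h3 := hx3 (i, j) ((hPmem _).2 hij)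
          have hl : (x i : ℕ) + 1 ≤ (x j : ℕ) + 1 := (hxm hij).le
          rw [role_image (fun i => (x i : ℕ) + 1) hxm i j]
          simp only [φ]
          rw [min_eq_left hl, max_eq_right hl, hψ', h3, hc _ hij]
        refine Finset.mem_coe.2 (Finset.mem_filter.2 ⟨Finset.mem_filter.2
          ⟨Finset.mem_powersetCard.2 ⟨hsub.trans hSn, ?_⟩, ?_⟩, hsub⟩)
        · rw [Finset.card_image_of_injective _ hxm.injective]; simp
        · intro u hu v hv huv
          obtain ⟨i, -, rfl⟩ := Finset.mem_image.1 hu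
          obtain ⟨j, -, rfl⟩ := Finset.mem_image.1 hv
          rcases lt_trichotomy i j with hij | hij | hij
          · exact hlt i j hij
          · exact absurd (by rw [hij]) huv
          · have := hlt j i hij
            rw [Finset.pair_comm, this]
            simp only [φ]
            rw [min_comm, max_comm]
      · intro x hx y hy hxy
        have hx1 := (Finset.mem_filter.1 hx).2.1
        have hy1 := (Finset.mem_filter.1 hy).2.1
        have hr : Set.range (fun i => (x i : ℕ) + 1) = Set.range (fun i => (y i : ℕ) + 1) := by
          have := congrArg (fun t : Finset ℕ => (t : Set ℕ)) hxy
          simpa [emb] using this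
        have := (StrictMono.range_inj (hmono x hx1) (hmono y hy1)).1 hr
        funext i
        have hi := congrFun this i
        exact Fin.ext (by omega)
    -- lower bound for the B-count
    have hNB : piR r * (S.card.choose r : ℝ)
        ≤ ∑ x : Fin r → Fin n, (∏ i, s (x i)) * ∏ p ∈ P, B p (x p.1) (x p.2) := by
      have hcard : S.card.choose r ≤ XB.card := by
        rw [← Finset.card_powersetCard]
        refine le_trans (Finset.card_le_card (t := XB.image emb) ?_) Finset.card_image_le
        intro e he
        obtain ⟨heS, hec⟩ := Finset.mem_powersetCard.1 he
        have hmem : ∀ i, e.orderEmbOfFin hec i ∈ S := fun i =>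
          heS (Finset.orderEmbOfFin_mem e hec i)
        have hbd : ∀ i, 1 ≤ e.orderEmbOfFin hec i ∧ e.orderEmbOfFin hec i ≤ n := fun i =>
          Finset.mem_Icc.1 (hSn (hmem i))
        let x : Fin r → Fin n := fun i => ⟨e.orderEmbOfFin hec i - 1, by have := hbd i; omega⟩
        have hxv : ∀ i, (x i : ℕ) + 1 = e.orderEmbOfFin hec i := by
          intro i; have := hbd i; simp only [x]; omega
        refine Finset.mem_image.2 ⟨x, Finset.mem_filter.2 ⟨Finset.mem_univ _, ?_, ?_⟩, ?_⟩
        · intro i j hij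
          have h1 : e.orderEmbOfFin hec i < e.orderEmbOfFin hec j :=
            (e.orderEmbOfFin hec).strictMono hij
          rw [← hxv, ← hxv] at h1
          exact Fin.lt_def.2 (by omega)
        · intro i; rw [hxv]; exact hmem i
        · simp only [emb, hxv]
          exact Finset.image_orderEmbOfFin_univ e hec
      have h2 : piR r * (XB.card : ℝ)
          ≤ ∑ x : Fin r → Fin n, (∏ i, s (x i)) * ∏ p ∈ P, B p (x p.1) (x p.2) := by
        rw [Finset.card_filter]
        push_cast
        rw [Finset.mul_sum]
        refine Finset.sum_le_sum fun x _ => ?_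
        split_ifs with hx
        · obtain ⟨hx1, hx2⟩ := hx
          have e1 : ∏ i, s (x i) = 1 := Finset.prod_eq_one fun i _ => by simp [s, hx2 i]
          have e2 : ∏ p ∈ P, B p (x p.1) (x p.2) = piR r := by
            rw [Finset.prod_congr rfl (g := fun _ => 1 / K) (fun p hp => by
              simp [B, w, hx1 ((hPmem p).1 hp)])]
            rw [Finset.prod_const, hPc, piR, ← hK]
            simp
          rw [e1, e2]; simp
        · rw [mul_zero]
          refine mul_nonneg (Finset.prod_nonneg fun i _ => ?_) (Finset.prod_nonneg fun p _ => ?_)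
          · simp only [s]; split_ifs <;> simp
          · refine mul_nonneg ?_ hKi0
            simp only [w]; split_ifs <;> simp
      refine le_trans ?_ h2
      refine mul_le_mul_of_nonneg_left (by exact_mod_cast hcard) ?_
      unfold piR; positivity
    refine le_trans (mul_le_mul_of_nonneg_left ?_ (by positivity)) htel
    refine le_trans ?_ (neg_le_abs _)
    linarith
  · intro u _ v _ _
    refine ⟨?_, ?_, ?_⟩
    · simp only [φ]; rw [min_comm, max_comm]
    · exact (Finset.mem_powersetCard.1 (ψ' (min u v) (max u v)).2).1
    · exact (Finset.mem_powersetCard.1 (ψ' (min u v) (max u v)).2).2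
  · intro e he
    exact (Finset.mem_filter.1 he).2

/-- `(C(r,2)^(-C(r,2)), δ)`-dense r-graphs on `[n]` together with a
pair-coloring φ such that every pair plays the role `φ {u,v}` in every edge
containing it. -/
theorem exists_dense_role_coloring (r : ℕ) (hr : 3 ≤ r) (δ : ℝ) (hδ : 0 < δ) :
    ∃ n₀ : ℕ, ∀ n ≥ n₀, ∃ H : RGraph r, ∃ φ : ℕ → ℕ → Finset ℕ,
      H.verts = Finset.Icc 1 n ∧
      IsDense H (piR r) δ ∧
      (∀ u ∈ H.verts, ∀ v ∈ H.verts, u ≠ v →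
        φ u v = φ v u ∧ φ u v ⊆ Finset.Icc 1 r ∧ (φ u v).card = 2) ∧
      (∀ e ∈ H.edges, ∀ u ∈ e, ∀ v ∈ e, u ≠ v → role id e {u, v} = φ u v) := by
  have hKpos : 0 < r.choose 2 := Nat.choose_pos (by omega)
  set K : ℝ := ((r.choose 2 : ℕ) : ℝ) with hK
  have hK0 : 0 < K := by rw [hK]; exact_mod_cast hKpos
  set c : ℝ := δ * ((δ / 2) ^ r / (r.factorial : ℝ)) with hc
  have hc0 : 0 < c := by
    have : (0 : ℝ) < r.factorial := by exact_mod_cast r.factorial_pos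
    positivity
  set t : ℝ := c / K with ht
  have ht0 : 0 < t := by positivity
  obtain ⟨N₁, hN₁⟩ := exists_nat_ge (2 * K / t ^ 4)
  obtain ⟨N₂, hN₂⟩ := exists_nat_ge (2 * r / δ)
  refine ⟨N₁ + N₂ + 1, fun n hn => ?_⟩
  have hn0 : (0 : ℝ) < n := by
    have : 0 < n := by omega
    exact_mod_cast this
  have hn1 : 2 * K / t ^ 4 ≤ n := hN₁.trans (by exact_mod_cast (by omega : N₁ ≤ n))
  have hn2 : 2 * r / δ ≤ n := hN₂.trans (by exact_mod_cast (by omega : N₂ ≤ n))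
  obtain ⟨H, φ, hv, hd, h1, h2⟩ := core r hr n
  refine ⟨H, φ, hv, ?_, h1, h2⟩
  intro S hS hSc
  have hvc : (H.verts.card : ℝ) = n := by rw [hv]; simp
  rw [hvc] at hSc
  have key := hd S hS (t * n ^ 2) (by positivity) (by
    rw [div_le_iff₀ (by positivity)] at hn1
    have := mul_le_mul_of_nonneg_right hn1 (by positivity : (0 : ℝ) ≤ (n : ℝ) ^ 7)
    calc _ ≤ _ := this
      _ = _ := by ring)
  rw [← hK] at key
  have e1 : K * ((n : ℝ) ^ r * (t * n ^ 2)) = (n : ℝ) ^ 2 * (c * (n : ℝ) ^ r) := by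
    rw [ht]; field_simp
  rw [e1] at key
  have key2 := le_of_mul_le_mul_left key (by positivity : (0 : ℝ) < (n : ℝ) ^ 2)
  have hch : (δ / 2) ^ r / (r.factorial : ℝ) * (n : ℝ) ^ r ≤ (S.card.choose r : ℝ) := by
    refine le_trans ?_ (Nat.pow_le_choose r S.card)
    rw [div_mul_eq_mul_div, ← mul_pow]
    refine div_le_div_of_nonneg_right ?_ (by positivity)
    refine pow_le_pow_left₀ (by positivity) ?_ r
    rw [div_le_iff₀ hδ] at hn2
    have hle : (r : ℝ) ≤ S.card := by nlinarith
    have hle' : r ≤ S.card + 1 := by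
      have : r ≤ S.card := by exact_mod_cast hle
      omega
    rw [Nat.cast_sub hle']
    push_cast
    nlinarith
  have := mul_le_mul_of_nonneg_left hch hδ.le
  have e2 : δ * ((δ / 2) ^ r / (r.factorial : ℝ) * (n : ℝ) ^ r) = c * (n : ℝ) ^ r := by
    rw [hc]; ring
  rw [e2] at this
  linarith

end UTD
end
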